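/- For any R > 0 and α ∈ [0, π/2), let u be the unique entire solution emanating from the planar front in the funnel-shaped domain Ω = Ω_{R,α}. Then 0 < u(t,x) ≤ φ(x₁ − ct) for all (t,x) ∈ ℝ × Ω̄; in particular, the solution never goes ahead of the planar front φ(x₁ − ct). -/

import Mathlib

open Set Filter Topology MeasureTheory

noncomputable section

/-- `ℝ^N` with `N = d+1`, Euclidean structure. -/
abbrev Euc (d : ℕ) := EuclideanSpace ℝ (Fin (d + 1))

/-- The Euclidean norm of `x' = (x₂,…,x_N)` for `x = (x₁,x') ∈ ℝ^N`. -/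
def primeNorm {d : ℕ} (x : Euc d) : ℝ :=
  Real.sqrt (∑ i, if i = 0 then 0 else (x i) ^ 2)

/-- The funnel-shaped domain `Ω = {x : |x'| < h(x₁)}`. -/
def funnel (d : ℕ) (h : ℝ → ℝ) : Set (Euc d) := {x | primeNorm x < h (x 0)}

/-- The Laplacian of `g` at `x`, computed with derivatives taken within the set `s`. -/
def lapW {d : ℕ} (s : Set (Euc d)) (g : Euc d → ℝ) (x : Euc d) : ℝ :=
  ∑ i, fderivWithin ℝ (fun y => fderivWithin ℝ g s y (EuclideanSpace.single i 1)) s x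
      (EuclideanSpace.single i 1)

/-- The quantity `ν·∇g` at a boundary point `x` of the funnel domain `Ω_{R,α}`, where
`ν(x) = (1+h'(x₁)²)^{-1/2}·(-h'(x₁), x'/|x'|)` is the outward unit normal. -/
def neumannLHS {d : ℕ} (h : ℝ → ℝ) (g : Euc d → ℝ) (x : Euc d) : ℝ :=
  (Real.sqrt (1 + deriv h (x 0) ^ 2))⁻¹ *
    (-(deriv h (x 0)) * fderivWithin ℝ g (closure (funnel d h)) x (EuclideanSpace.single 0 1)
      + ∑ i, if i = 0 then 0 else
          (x i / primeNorm x) *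
            fderivWithin ℝ g (closure (funnel d h)) x (EuclideanSpace.single i 1))

/-- The bistable nonlinearity `f`, of class `C^{1,1}`, with positive mass, extended affinely
outside `[0,1]`. -/
structure Bistable (f : ℝ → ℝ) (θ : ℝ) : Prop where
  smooth : ContDiff ℝ 1 f
  lip_deriv : ∃ C : NNReal, LipschitzWith C (deriv f)
  f0 : f 0 = 0
  f1 : f 1 = 0
  df0 : deriv f 0 < 0
  df1 : deriv f 1 < 0
  θmem : θ ∈ Ioo (0 : ℝ) 1
  neg : ∀ s ∈ Ioo (0 : ℝ) θ, f s < 0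
  pos : ∀ s ∈ Ioo θ (1 : ℝ), 0 < f s
  dθ : 0 < deriv f θ
  mass : 0 < ∫ s in (0 : ℝ)..1, f s
  ext_neg : ∀ s < (0 : ℝ), f s = deriv f 0 * s
  ext_pos : ∀ s > (1 : ℝ), f s = deriv f 1 * (s - 1)

/-- The planar traveling front `φ(x₁ - ct)`: `φ'' + cφ' + f(φ) = 0`, `φ(-∞) = 1`,
`φ(+∞) = 0`, `0 < φ < 1`, `φ` decreasing, normalized by `φ(0) = θ`, with speed `c > 0`. -/
structure PlanarFront (f : ℝ → ℝ) (θ c : ℝ) (φ : ℝ → ℝ) : Prop where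
  cpos : 0 < c
  mem : ∀ z : ℝ, φ z ∈ Ioo (0 : ℝ) 1
  smooth : ContDiff ℝ 2 φ
  anti : StrictAnti φ
  ode : ∀ z : ℝ, deriv (deriv φ) z + c * deriv φ z + f (φ z) = 0
  lim_bot : Tendsto φ atBot (nhds 1)
  lim_top : Tendsto φ atTop (nhds 0)
  pin : φ 0 = θ

/-- `h : ℝ → ℝ` defines a funnel-shaped domain `Ω_{R,α}` (of dimension `N = d+1 ≥ 2`) with
cylinder radius `R`, opening angle `α` and transition parameter `L`. -/
structure IsFunnel (d : ℕ) (R α L : ℝ) (h : ℝ → ℝ) : Prop where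
  dpos : 1 ≤ d
  Rpos : 0 < R
  αmem : α ∈ Ico (0 : ℝ) (Real.pi / 2)
  RL : R < L
  smooth : ContDiff ℝ 2 h
  holder : ∃ β : NNReal, 0 < β ∧ (β : ℝ) < 1 ∧ ∃ C : NNReal, HolderWith C β (deriv (deriv h))
  deriv_nonneg : ∀ x : ℝ, 0 ≤ deriv h x
  deriv_le : ∀ x : ℝ, deriv h x ≤ Real.tan α
  left : ∀ x ≤ (0 : ℝ), h x = R
  right : ∀ x : ℝ, L * Real.cos α ≤ x → h x = x * Real.tan α

/-- An entire solution of `u_t = Δu + f(u)` in `ℝ × Ω̄` (with values in `[0,1]`),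
Neumann boundary condition `ν·∇u = 0` on `ℝ × ∂Ω`, emanating from the planar front
`φ(x₁ - ct)` as `t → -∞`. -/
structure IsEntireSolution (d : ℕ) (h f : ℝ → ℝ) (c : ℝ) (φ : ℝ → ℝ)
    (u : ℝ → Euc d → ℝ) : Prop where
  range01 : ∀ t : ℝ, ∀ x ∈ closure (funnel d h), u t x ∈ Icc (0 : ℝ) 1
  time_diff : ∀ x ∈ closure (funnel d h), Differentiable ℝ fun t => u t x
  space_reg : ∀ t : ℝ, ContDiffOn ℝ 2 (u t) (closure (funnel d h))
  pde : ∀ t : ℝ, ∀ x ∈ closure (funnel d h),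
      deriv (fun s => u s x) t = lapW (closure (funnel d h)) (u t) x + f (u t x)
  neumann : ∀ t : ℝ, ∀ x ∈ frontier (funnel d h), neumannLHS h (u t) x = 0
  past : ∀ ε > (0 : ℝ), ∃ T : ℝ, ∀ t ≤ T, ∀ x ∈ closure (funnel d h),
      |u t x - φ (x 0 - c * t)| ≤ ε

/-- Complete propagation: `u(t,x) → 1` as `t → +∞` locally uniformly in `x ∈ Ω̄`. -/
def CompletePropagation (d : ℕ) (h : ℝ → ℝ) (u : ℝ → Euc d → ℝ) : Prop :=
  TendstoLocallyUniformlyOn u (fun _ => (1 : ℝ)) atTop (closure (funnel d h))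

/-- Blocking: `u(t,·)` converges uniformly on `Ω̄`, as `t → +∞`, to a stationary solution
`u_∞` with `u_∞(x) → 0` as `x₁ → +∞`. -/
def Blocked (d : ℕ) (h f : ℝ → ℝ) (u : ℝ → Euc d → ℝ) : Prop :=
  ∃ uinf : Euc d → ℝ,
    TendstoUniformlyOn u uinf atTop (closure (funnel d h)) ∧
    ContDiffOn ℝ 2 uinf (closure (funnel d h)) ∧
    (∀ x ∈ closure (funnel d h), lapW (closure (funnel d h)) uinf x + f (uinf x) = 0) ∧
    (∀ x ∈ frontier (funnel d h), neumannLHS h uinf x = 0) ∧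
    (∀ ε > (0 : ℝ), ∃ A : ℝ, ∀ x ∈ closure (funnel d h), A ≤ x 0 → |uinf x| ≤ ε)

/-- Stability of a solution `U` of `ΔU + f(U) = 0` on `s̄`:
`∫_s (|∇ψ|² - f'(U)ψ²) ≥ 0` for all compactly supported `C¹` functions `ψ`. -/
def StableOn {d : ℕ} (s : Set (Euc d)) (f : ℝ → ℝ) (U : Euc d → ℝ) : Prop :=
  ∀ ψ : Euc d → ℝ, ContDiff ℝ 1 ψ → HasCompactSupport ψ →
    0 ≤ ∫ x in s, (‖gradient ψ x‖ ^ 2 - deriv f (U x) * ψ x ^ 2)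

/-- The square of the norm of the transversal component. -/
def sqPrime {d : ℕ} (x : Euc d) : ℝ := ∑ i : Fin d, x i.succ ^ 2

/-- A defining function of the funnel: positive exactly in the domain. -/
def funnelFun {d : ℕ} (h : ℝ → ℝ) (x : Euc d) : ℝ := h (x 0) ^ 2 - sqPrime x

/-- An outward normal vector field (not normalised). -/
def outNormal {d : ℕ} (h : ℝ → ℝ) (x : Euc d) : Euc d :=
  WithLp.toLp 2 (Fin.cons (-(h (x 0) * deriv h (x 0))) fun i : Fin d => x i.succ)

/-- The derivative of `g` along the outward normal field, within the closed funnel. -/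
def normalDeriv {d : ℕ} (h : ℝ → ℝ) (g : Euc d → ℝ) (x : Euc d) : ℝ :=
  fderivWithin ℝ g (closure (funnel d h)) x (outNormal h x)

/-- The properties of the profile used by the comparison argument. -/
structure Profile (h : ℝ → ℝ) : Prop where
  smooth : ContDiff ℝ 2 h
  pos : ∀ s, 0 < h s
  mono : Monotone h

lemma primeNorm_eq {d : ℕ} (x : Euc d) : primeNorm x = Real.sqrt (sqPrime x) := by
  simp [primeNorm, sqPrime, Fin.sum_univ_succ]

lemma sqPrime_nonneg {d : ℕ} (x : Euc d) : 0 ≤ sqPrime x :=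
  Finset.sum_nonneg fun _ _ => sq_nonneg _

lemma contDiff_coord {d : ℕ} (i : Fin (d + 1)) {n : WithTop ℕ∞} :
    ContDiff ℝ n fun x : Euc d => x i :=
  (EuclideanSpace.proj (𝕜 := ℝ) i).contDiff

lemma contDiff_sqPrime {d : ℕ} {n : WithTop ℕ∞} : ContDiff ℝ n (sqPrime (d := d)) :=
  ContDiff.sum fun i _ => (contDiff_coord i.succ).pow 2

lemma fderiv_coord {d : ℕ} (i : Fin (d + 1)) (x v : Euc d) :
    fderiv ℝ (fun x : Euc d => x i) x v = v i := by
  have := (EuclideanSpace.proj (𝕜 := ℝ) i : Euc d →L[ℝ] ℝ).hasFDerivAt (x := x)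
  exact congrArg (fun L : Euc d →L[ℝ] ℝ => L v) this.fderiv

lemma hasFDerivAt_coord {d : ℕ} (i : Fin (d + 1)) (x : Euc d) :
    HasFDerivAt (fun x : Euc d => x i) (EuclideanSpace.proj (𝕜 := ℝ) i : Euc d →L[ℝ] ℝ) x :=
  (EuclideanSpace.proj (𝕜 := ℝ) i : Euc d →L[ℝ] ℝ).hasFDerivAt

lemma fderiv_sqPrime {d : ℕ} (x v : Euc d) :
    fderiv ℝ sqPrime x v = 2 * ∑ i : Fin d, x i.succ * v i.succ := by
  have : HasFDerivAt (sqPrime (d := d)) (∑ i : Fin d, (2 * x i.succ ^ 1) •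
      (EuclideanSpace.proj (𝕜 := ℝ) i.succ : Euc d →L[ℝ] ℝ)) x :=
    HasFDerivAt.fun_sum fun i _ => by
      simpa using (hasFDerivAt_coord i.succ x).pow 2
  rw [this.fderiv]
  simp [Finset.mul_sum, mul_assoc]

lemma Profile.contDiff_funnelFun {d : ℕ} {h : ℝ → ℝ} (H : Profile h) :
    ContDiff ℝ 2 (funnelFun (d := d) h) :=
  ((H.smooth.comp (contDiff_coord 0)).pow 2).sub contDiff_sqPrime

lemma Profile.fderiv_funnelFun {d : ℕ} {h : ℝ → ℝ} (H : Profile h) (x v : Euc d) :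
    fderiv ℝ (funnelFun h) x v = -2 * ∑ i, outNormal h x i * v i := by
  have h1 : HasFDerivAt (fun x : Euc d => h (x 0)) (deriv h (x 0) •
      (EuclideanSpace.proj (𝕜 := ℝ) 0 : Euc d →L[ℝ] ℝ)) x :=
    ((H.smooth.differentiable (by norm_num)) (x 0)).hasDerivAt.comp_hasFDerivAt x
      (hasFDerivAt_coord 0 x)
  have h2 := (h1.pow 2).sub
    ((contDiff_sqPrime (n := 2)).differentiable (by norm_num) x).hasFDerivAt
  have h3 : fderiv ℝ (funnelFun h) x = _ := h2.fderiv
  rw [h3]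
  simp [fderiv_sqPrime, Fin.sum_univ_succ, outNormal]
  ring

lemma Profile.mem_funnel {d : ℕ} {h : ℝ → ℝ} (H : Profile h) {x : Euc d} :
    x ∈ funnel d h ↔ 0 < funnelFun h x := by
  rw [funnel, mem_ofPred_eq, primeNorm_eq, Real.sqrt_lt' (H.pos _), funnelFun, sub_pos]

lemma Profile.isOpen_funnel {d : ℕ} {h : ℝ → ℝ} (H : Profile h) : IsOpen (funnel d h) := by
  have : funnel d h = {x | 0 < funnelFun h x} := by ext x; exact H.mem_funnel
  rw [this]
  exact isOpen_lt continuous_const H.contDiff_funnelFun.continuous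

lemma Profile.funnelFun_nonneg {d : ℕ} {h : ℝ → ℝ} (H : Profile h) {x : Euc d}
    (hx : x ∈ closure (funnel d h)) : 0 ≤ funnelFun h x := by
  have : closure (funnel d h) ⊆ {x | 0 ≤ funnelFun h x} :=
    closure_minimal (fun x hx => (H.mem_funnel.1 hx).le)
      (isClosed_le continuous_const H.contDiff_funnelFun.continuous)
  exact this hx

lemma Profile.mem_frontier {d : ℕ} {h : ℝ → ℝ} (H : Profile h) {x : Euc d} :
    x ∈ frontier (funnel d h) ↔ x ∈ closure (funnel d h) ∧ funnelFun h x = 0 := by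
  rw [frontier, H.isOpen_funnel.interior_eq, Set.mem_sdiff, H.mem_funnel]
  refine and_congr_right fun hx => ⟨fun h' => ?_, fun h' => ?_⟩
  · exact le_antisymm (not_lt.1 h') (H.funnelFun_nonneg hx)
  · simp [h']

lemma Profile.uniqueDiffOn {d : ℕ} {h : ℝ → ℝ} (H : Profile h) :
    UniqueDiffOn ℝ (closure (funnel d h)) := by
  intro x hx
  set C : Set (Euc d) := {y | x 0 < y 0} ∩ {y | sqPrime y < h (x 0) ^ 2} with hC
  have hsub : C ⊆ closure (funnel d h) := by
    intro y hy
    refine subset_closure (H.mem_funnel.2 ?_)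
    have h1 := H.mono (le_of_lt hy.1)
    have h2 : sqPrime y < h (x 0) ^ 2 := hy.2
    have h3 := H.pos (x 0)
    rw [funnelFun]
    nlinarith
  have hopen : IsOpen C :=
    (isOpen_lt continuous_const (contDiff_coord 0 (n := 0)).continuous).inter
      (isOpen_lt (contDiff_sqPrime (n := 0)).continuous continuous_const)
  have hconv : Convex ℝ C := by
    refine Convex.inter ?_ ?_
    · exact convex_halfSpace_gt (f := fun y : Euc d => y 0) ⟨fun _ _ => rfl, fun _ _ => rfl⟩ _
    · have : ConvexOn ℝ univ (sqPrime (d := d)) := by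
        refine ⟨convex_univ, fun a _ b _ s t hs ht hst => ?_⟩
        simp only [sqPrime, smul_eq_mul, Finset.mul_sum, ← Finset.sum_add_distrib]
        refine Finset.sum_le_sum fun i _ => ?_
        have : t = 1 - s := by linarith
        subst this
        simp only [PiLp.add_apply, PiLp.smul_apply, smul_eq_mul]
        nlinarith [mul_nonneg (mul_nonneg hs ht) (sq_nonneg (a i.succ - b i.succ))]
      simpa using this.convex_lt (h (x 0) ^ 2)
  have hxq : sqPrime x ≤ h (x 0) ^ 2 := by
    have := H.funnelFun_nonneg hx
    rw [funnelFun] at this; linarith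
  -- a path in `C` which tends to `x`
  let γ : ℝ → Euc d := fun s =>
    WithLp.toLp 2 (Fin.cons (x 0 + s) fun i : Fin d => (1 - s) * x i.succ)
  have hγ : ∀ s ∈ Ioo (0 : ℝ) 1, γ s ∈ C := by
    intro s hs
    refine ⟨by simp [γ, hs.1], ?_⟩
    have : sqPrime (γ s) = (1 - s) ^ 2 * sqPrime x := by
      simp [sqPrime, γ, Finset.mul_sum, mul_pow]
    rw [mem_ofPred_eq, this]
    have h1 : 0 < h (x 0) ^ 2 := pow_pos (H.pos _) 2
    have h2 : (1 - s) ^ 2 < 1 := by nlinarith [hs.1, hs.2]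
    nlinarith [sqPrime_nonneg x, sq_nonneg (1 - s)]
  have hγc : Continuous γ := by
    refine (PiLp.continuous_toLp 2 _).comp (continuous_pi fun i => ?_)
    refine Fin.cases ?_ (fun j => ?_) i
    · simp only [Fin.cons_zero]; fun_prop
    · simp only [Fin.cons_succ]; fun_prop
  have hγ0 : γ 0 = x := by
    ext i
    refine Fin.cases ?_ (fun j => ?_) i <;> simp [γ]
  have hxC : x ∈ closure C := by
    rw [← hγ0]
    refine mem_closure_of_tendsto (hγc.tendsto 0 |>.mono_left nhdsWithin_le_nhds :
      Tendsto γ (𝓝[>] 0) _) ?_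
    filter_upwards [Ioo_mem_nhdsGT (zero_lt_one : (0 : ℝ) < 1)] with s hs using hγ s hs
  have hne : (interior C).Nonempty := by
    rw [hopen.interior_eq]
    exact ⟨γ (1 / 2), hγ _ (by norm_num)⟩
  exact (uniqueDiffWithinAt_convex hconv hne hxC).mono hsub

/-- Expansion of a linear form in the standard basis. -/
lemma clm_apply_eq_sum {d : ℕ} (A : Euc d →L[ℝ] ℝ) (v : Euc d) :
    A v = ∑ i, v i * A (EuclideanSpace.single i 1) := by
  have : v = ∑ i, v i • EuclideanSpace.single i (1 : ℝ) := by
    ext j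
    simp [Finset.sum_apply, Pi.single_apply]
  conv_lhs => rw [this]
  simp

lemma Profile.neumannLHS_eq {d : ℕ} {h : ℝ → ℝ} (H : Profile h) (g : Euc d → ℝ) {x : Euc d}
    (hx : x ∈ frontier (funnel d h)) :
    neumannLHS h g x =
      (Real.sqrt (1 + deriv h (x 0) ^ 2))⁻¹ * (h (x 0))⁻¹ * normalDeriv h g x := by
  have h0 := (H.mem_frontier.1 hx).2
  have h1 : primeNorm x = h (x 0) := by
    rw [primeNorm_eq, Real.sqrt_eq_iff_mul_self_eq (sqPrime_nonneg x) (H.pos _).le]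
    rw [funnelFun] at h0; nlinarith
  have h2 := (H.pos (x 0)).ne'
  rw [neumannLHS, normalDeriv, clm_apply_eq_sum _ (outNormal h x), h1, mul_assoc]
  congr 1
  simp only [Fin.sum_univ_succ, outNormal]
  simp only [if_true, Fin.succ_ne_zero, if_false, Fin.cons_zero, Fin.cons_succ, zero_add,
    mul_add, Finset.mul_sum]
  congr 1
  · field_simp
  · refine Finset.sum_congr rfl fun i _ => ?_
    field_simp

section Laplacian

variable {d : ℕ} {s : Set (Euc d)}

lemma ContDiffOn.partialWithin {g : Euc d → ℝ} (hs : UniqueDiffOn ℝ s) (hg : ContDiffOn ℝ 2 g s)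
    (v : Euc d) : ContDiffOn ℝ 1 (fun y => fderivWithin ℝ g s y v) s :=
  (hg.fderivWithin hs (m := 1) (by norm_num)).clm_apply contDiffOn_const

lemma lapW_add {g k : Euc d → ℝ} (hs : UniqueDiffOn ℝ s) (hg : ContDiffOn ℝ 2 g s)
    (hk : ContDiffOn ℝ 2 k s) {x : Euc d} (hx : x ∈ s) :
    lapW s (fun y => g y + k y) x = lapW s g x + lapW s k x := by
  rw [lapW, lapW, lapW, ← Finset.sum_add_distrib]
  refine Finset.sum_congr rfl fun i _ => ?_
  have h1 : EqOn (fun y => fderivWithin ℝ (fun y => g y + k y) s y (EuclideanSpace.single i 1))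
      (fun y => fderivWithin ℝ g s y (EuclideanSpace.single i 1)
        + fderivWithin ℝ k s y (EuclideanSpace.single i 1)) s := fun y hy => by
    simp only
    rw [fderivWithin_fun_add (hs y hy) (hg.differentiableOn (by norm_num) y hy)
      (hk.differentiableOn (by norm_num) y hy)]
    rfl
  rw [fderivWithin_congr h1 (h1 hx), fderivWithin_fun_add (hs x hx)
    ((hg.partialWithin hs _).differentiableOn (by norm_num) x hx)
    ((hk.partialWithin hs _).differentiableOn (by norm_num) x hx)]
  rfl

lemma lapW_const_mul {g : Euc d → ℝ} (hs : UniqueDiffOn ℝ s) (hg : ContDiffOn ℝ 2 g s) (a : ℝ)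
    {x : Euc d} (hx : x ∈ s) : lapW s (fun y => a * g y) x = a * lapW s g x := by
  rw [lapW, lapW, Finset.mul_sum]
  refine Finset.sum_congr rfl fun i _ => ?_
  have h1 : EqOn (fun y => fderivWithin ℝ (fun y => a * g y) s y (EuclideanSpace.single i 1))
      (fun y => a * fderivWithin ℝ g s y (EuclideanSpace.single i 1)) s := fun y hy => by
    simp only
    rw [fderivWithin_const_mul (hs y hy) (hg.differentiableOn (by norm_num) y hy)]
    rfl
  rw [fderivWithin_congr h1 (h1 hx), fderivWithin_const_mul (hs x hx)
    ((hg.partialWithin hs _).differentiableOn (by norm_num) x hx)]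
  rfl

lemma lapW_sub {g k : Euc d → ℝ} (hs : UniqueDiffOn ℝ s) (hg : ContDiffOn ℝ 2 g s)
    (hk : ContDiffOn ℝ 2 k s) {x : Euc d} (hx : x ∈ s) :
    lapW s (fun y => g y - k y) x = lapW s g x - lapW s k x := by
  have h1 : (fun y => g y - k y) = fun y => g y + (-1) * k y := by ext y; ring
  rw [h1, lapW_add hs hg (contDiffOn_const.mul hk) hx, lapW_const_mul hs hk _ hx]
  ring

lemma lapW_const (a : ℝ) (x : Euc d) : lapW s (fun _ => a) x = 0 := by
  simp [lapW, fderivWithin_fun_const]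

lemma continuousOn_lapW {g : Euc d → ℝ} (hs : UniqueDiffOn ℝ s) (hg : ContDiffOn ℝ 2 g s) :
    ContinuousOn (lapW s g) s :=
  continuousOn_finsetSum _ fun _ _ =>
    ((hg.partialWithin hs _).continuousOn_fderivWithin hs (by norm_num)).clm_apply
      continuousOn_const

/-- The Laplacian of a composition with a function of one variable. -/
lemma lapW_comp {G : Euc d → ℝ} {F : ℝ → ℝ} (hs : UniqueDiffOn ℝ s) (hG : ContDiffOn ℝ 2 G s)
    (hF : ContDiff ℝ 2 F) {x : Euc d} (hx : x ∈ s) :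
    lapW s (fun y => F (G y)) x =
      deriv (deriv F) (G x) * ∑ i, fderivWithin ℝ G s x (EuclideanSpace.single i 1) ^ 2
        + deriv F (G x) * lapW s G x := by
  have hF' : ContDiff ℝ 1 (deriv F) := by
    have : ContDiff ℝ (1 + 1) F := by simpa [one_add_one_eq_two] using hF
    exact ((contDiff_succ_iff_deriv).1 this).2.2
  rw [lapW, lapW, Finset.mul_sum, Finset.mul_sum, ← Finset.sum_add_distrib]
  refine Finset.sum_congr rfl fun i _ => ?_
  set e : Euc d := EuclideanSpace.single i 1
  have hGd := hG.differentiableOn (by norm_num)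
  have h1 : EqOn (fun y => fderivWithin ℝ (fun y => F (G y)) s y e)
      (fun y => deriv F (G y) * fderivWithin ℝ G s y e) s := fun y hy => by
    have := ((hF.differentiable (by norm_num)) (G y)).hasDerivAt.comp_hasFDerivWithinAt y
      (hGd y hy).hasFDerivWithinAt
    simp only
    rw [show (fun y => F (G y)) = F ∘ G from rfl, this.fderivWithin (hs y hy)]
    rfl
  have h2 := ((hF'.differentiable (by norm_num)) (G x)).hasDerivAt.comp_hasFDerivWithinAt x
      (hGd x hx).hasFDerivWithinAt
  have h3 := ((hG.partialWithin hs e).differentiableOn (by norm_num) x hx).hasFDerivWithinAt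
  have h4 := h2.mul h3
  rw [fderivWithin_congr h1 (h1 hx)]
  have h5 : fderivWithin ℝ (fun y => deriv F (G y) * fderivWithin ℝ G s y e) s x = _ :=
    h4.fderivWithin (hs x hx)
  rw [h5]
  simp
  ring

/-- For a globally smooth function the derivatives can be taken in the whole space. -/
lemma lapW_eq_of_contDiff {G : Euc d → ℝ} (hs : UniqueDiffOn ℝ s) (hG : ContDiff ℝ 2 G)
    {x : Euc d} (hx : x ∈ s) :
    lapW s G x = ∑ i, fderiv ℝ (fun y => fderiv ℝ G y (EuclideanSpace.single i 1)) x
      (EuclideanSpace.single i 1) := by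
  refine Finset.sum_congr rfl fun i _ => ?_
  have h1 : EqOn (fun y => fderivWithin ℝ G s y (EuclideanSpace.single i 1))
      (fun y => fderiv ℝ G y (EuclideanSpace.single i 1)) s := fun y hy => by
    simp only
    rw [((hG.differentiable (by norm_num)) y).fderivWithin (hs y hy)]
  rw [fderivWithin_congr h1 (h1 hx)]
  have h2 : ContDiff ℝ 1 (fun y => fderiv ℝ G y (EuclideanSpace.single i 1)) :=
    (hG.fderiv_right (m := 1) (by norm_num)).clm_apply contDiff_const
  rw [((h2.differentiable (by norm_num)) x).fderivWithin (hs x hx)]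

end Laplacian

section NormalDerivative

variable {d : ℕ} {h : ℝ → ℝ}

lemma Profile.normalDeriv_add (H : Profile h) {g k : Euc d → ℝ}
    (hg : ContDiffOn ℝ 2 g (closure (funnel d h))) (hk : ContDiffOn ℝ 2 k (closure (funnel d h)))
    {x : Euc d} (hx : x ∈ closure (funnel d h)) :
    normalDeriv h (fun y => g y + k y) x = normalDeriv h g x + normalDeriv h k x := by
  rw [normalDeriv, fderivWithin_fun_add (H.uniqueDiffOn x hx)
    (hg.differentiableOn (by norm_num) x hx) (hk.differentiableOn (by norm_num) x hx)]
  rfl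

lemma Profile.normalDeriv_const_mul (H : Profile h) {g : Euc d → ℝ}
    (hg : ContDiffOn ℝ 2 g (closure (funnel d h))) (a : ℝ)
    {x : Euc d} (hx : x ∈ closure (funnel d h)) :
    normalDeriv h (fun y => a * g y) x = a * normalDeriv h g x := by
  rw [normalDeriv, fderivWithin_const_mul (H.uniqueDiffOn x hx)
    (hg.differentiableOn (by norm_num) x hx)]
  rfl

lemma Profile.normalDeriv_sub (H : Profile h) {g k : Euc d → ℝ}
    (hg : ContDiffOn ℝ 2 g (closure (funnel d h))) (hk : ContDiffOn ℝ 2 k (closure (funnel d h)))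
    {x : Euc d} (hx : x ∈ closure (funnel d h)) :
    normalDeriv h (fun y => g y - k y) x = normalDeriv h g x - normalDeriv h k x := by
  rw [normalDeriv, fderivWithin_fun_sub (H.uniqueDiffOn x hx)
    (hg.differentiableOn (by norm_num) x hx) (hk.differentiableOn (by norm_num) x hx)]
  rfl

lemma normalDeriv_const (a : ℝ) (x : Euc d) : normalDeriv h (fun _ => a) x = 0 := by
  simp [normalDeriv, fderivWithin_fun_const]

lemma Profile.normalDeriv_comp (H : Profile h) {G : Euc d → ℝ} {F : ℝ → ℝ}
    (hG : ContDiffOn ℝ 2 G (closure (funnel d h))) (hF : ContDiff ℝ 2 F) {x : Euc d}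
    (hx : x ∈ closure (funnel d h)) :
    normalDeriv h (fun y => F (G y)) x = deriv F (G x) * normalDeriv h G x := by
  have := ((hF.differentiable (by norm_num)) (G x)).hasDerivAt.comp_hasFDerivWithinAt x
      (hG.differentiableOn (by norm_num) x hx).hasFDerivWithinAt
  rw [normalDeriv, show (fun y => F (G y)) = F ∘ G from rfl,
    this.fderivWithin (H.uniqueDiffOn x hx)]
  rfl

lemma Profile.normalDeriv_eq_fderiv (H : Profile h) {G : Euc d → ℝ} (hG : ContDiff ℝ 2 G)
    {x : Euc d} (hx : x ∈ closure (funnel d h)) :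
    normalDeriv h G x = fderiv ℝ G x (outNormal h x) := by
  rw [normalDeriv, ((hG.differentiable (by norm_num)) x).fderivWithin (H.uniqueDiffOn x hx)]

lemma Profile.continuous_outNormal (H : Profile h) : Continuous (outNormal (d := d) h) := by
  have hd : Continuous (deriv h) := H.smooth.continuous_deriv (by norm_num)
  have hh := H.smooth.continuous
  refine (PiLp.continuous_toLp 2 _).comp (continuous_pi fun i => ?_)
  refine Fin.cases ?_ (fun j => ?_) i
  · simp only [Fin.cons_zero]; fun_prop
  · simp only [Fin.cons_succ]; fun_prop

lemma Profile.continuousOn_normalDeriv (H : Profile h) {g : Euc d → ℝ}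
    (hg : ContDiffOn ℝ 2 g (closure (funnel d h))) :
    ContinuousOn (normalDeriv h g) (closure (funnel d h)) :=
  (hg.continuousOn_fderivWithin H.uniqueDiffOn (by norm_num)).clm_apply
    H.continuous_outNormal.continuousOn

lemma Profile.normalDeriv_sqPrime_pos (H : Profile h) {x : Euc d}
    (hx : x ∈ frontier (funnel d h)) : 0 < normalDeriv h sqPrime x := by
  obtain ⟨h1, h2⟩ := H.mem_frontier.1 hx
  rw [H.normalDeriv_eq_fderiv contDiff_sqPrime h1, fderiv_sqPrime]
  have : ∑ i : Fin d, x i.succ * outNormal h x i.succ = h (x 0) ^ 2 := by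
    rw [funnelFun, sqPrime] at h2
    rw [← sub_eq_zero, ← neg_eq_zero, neg_sub, ← h2]
    simp [outNormal, sq]
  rw [this]
  have := H.pos (x 0)
  positivity

end NormalDerivative

lemma hasDerivAt_max_zero_pow (n : ℕ) (s : ℝ) :
    HasDerivAt (fun s : ℝ => max s 0 ^ (n + 2)) ((n + 2) * max s 0 ^ (n + 1)) s := by
  have hne : ∀ y : ℝ, y ≠ 0 →
      HasDerivAt (fun s : ℝ => max s 0 ^ (n + 2)) ((n + 2) * max y 0 ^ (n + 1)) y := by
    intro y hy
    rcases lt_or_gt_of_ne hy with h | h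
    · have : (fun s : ℝ => max s 0 ^ (n + 2)) =ᶠ[𝓝 y] fun _ => 0 := by
        filter_upwards [gt_mem_nhds h] with z hz
        simp [max_eq_right (le_of_lt hz)]
      simpa [max_eq_right h.le] using (hasDerivAt_const y (0 : ℝ)).congr_of_eventuallyEq this
    · have : (fun s : ℝ => max s 0 ^ (n + 2)) =ᶠ[𝓝 y] fun s => s ^ (n + 2) := by
        filter_upwards [lt_mem_nhds h] with z hz
        simp [max_eq_left (le_of_lt hz)]
      simpa [max_eq_left h.le] using (hasDerivAt_pow (n + 2) y).congr_of_eventuallyEq this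
  rcases eq_or_ne s 0 with rfl | h
  · exact hasDerivAt_of_hasDerivAt_of_ne (g := fun y => (n + 2) * max y 0 ^ (n + 1)) hne
      (by fun_prop) (by fun_prop)
  · exact hne s h

lemma deriv_max_zero_sq : deriv (fun s : ℝ => max s 0 ^ 2) = fun s => 2 * max s 0 := by
  ext s
  simpa using (hasDerivAt_max_zero_pow 0 s).deriv

lemma deriv_max_zero_cube : deriv (fun s : ℝ => max s 0 ^ 3) = fun s => 3 * max s 0 ^ 2 := by
  ext s
  rw [(hasDerivAt_max_zero_pow 1 s).deriv]
  norm_num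

lemma contDiff_max_zero_sq : ContDiff ℝ 1 fun s : ℝ => max s 0 ^ 2 := by
  rw [contDiff_one_iff_deriv, deriv_max_zero_sq]
  exact ⟨fun s => (hasDerivAt_max_zero_pow 0 s).differentiableAt, by fun_prop⟩

lemma contDiff_max_zero_cube : ContDiff ℝ 2 fun s : ℝ => max s 0 ^ 3 := by
  have : ContDiff ℝ (1 + 1) fun s : ℝ => max s 0 ^ 3 := by
    rw [contDiff_succ_iff_deriv, deriv_max_zero_cube]
    exact ⟨fun s => (hasDerivAt_max_zero_pow 1 s).differentiableAt, by simp,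
      contDiff_const.mul contDiff_max_zero_sq⟩
  simpa [one_add_one_eq_two] using this

lemma integral_fderiv_apply_eq_zero {d : ℕ} {V : Euc d → ℝ} (hV : ContDiff ℝ 1 V)
    (hc : HasCompactSupport V) (v : Euc d) : ∫ x, fderiv ℝ V x v = 0 := by
  have h1 : Integrable (fun x => fderiv ℝ V x v) :=
    (hV.continuous_fderiv_apply (by norm_num) |>.comp
      (Continuous.prodMk continuous_id continuous_const)).integrable_of_hasCompactSupport
      (hc.fderiv_apply ℝ v)
  have h2 : Integrable V := hV.continuous.integrable_of_hasCompactSupport hc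
  have := integral_mul_fderiv_eq_neg_fderiv_mul_of_integrable (μ := (volume : Measure (Euc d)))
    (f := fun _ => (1 : ℝ)) (g := V) (v := v) (by simp) (by simpa using h1) (by simpa using h2)
    (fun _ _ => differentiableAt_const _) (fun x _ => hV.differentiable (by norm_num) x)
  simpa using this

/-- A cut-off function which vanishes near the complement of the funnel and tends to `1` in the
funnel as `ε → 0`. -/
def funnelCutoff {d : ℕ} (h : ℝ → ℝ) (ε : ℝ) (x : Euc d) : ℝ :=
  Real.smoothTransition (ε⁻¹ * funnelFun h x - 1)

lemma funnelCutoff_eq_zero {d : ℕ} {h : ℝ → ℝ} {ε : ℝ} (hε : 0 < ε) {x : Euc d}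
    (hx : funnelFun h x ≤ ε) : funnelCutoff h ε x = 0 := by
  refine Real.smoothTransition.zero_of_nonpos ?_
  have : ε⁻¹ * funnelFun h x ≤ ε⁻¹ * ε := by gcongr
  rw [inv_mul_cancel₀ hε.ne'] at this
  linarith

lemma funnelCutoff_eq_one {d : ℕ} {h : ℝ → ℝ} {ε : ℝ} (hε : 0 < ε) {x : Euc d}
    (hx : 2 * ε ≤ funnelFun h x) : funnelCutoff h ε x = 1 := by
  refine Real.smoothTransition.one_of_one_le ?_
  have : ε⁻¹ * (2 * ε) ≤ ε⁻¹ * funnelFun h x := by gcongr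
  have h2 : ε⁻¹ * (2 * ε) = 2 := by field_simp
  linarith

lemma smoothTransition_monotone : Monotone Real.smoothTransition := by
  intro a b hab
  have key : ∀ s : ℝ, Real.smoothTransition s
      = expNegInvGlue s / (expNegInvGlue s + expNegInvGlue (1 - s)) := fun _ => rfl
  rw [key, key, div_le_div_iff₀ (Real.smoothTransition.pos_denom a)
    (Real.smoothTransition.pos_denom b)]
  have h1 := expNegInvGlue.monotone hab
  have h2 := expNegInvGlue.monotone (show 1 - b ≤ 1 - a by linarith)
  nlinarith [expNegInvGlue.nonneg a, expNegInvGlue.nonneg b, expNegInvGlue.nonneg (1 - a),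
    expNegInvGlue.nonneg (1 - b), mul_le_mul h1 h2 (expNegInvGlue.nonneg _)
      (expNegInvGlue.nonneg b)]

section Green

variable {d : ℕ} {h : ℝ → ℝ}

lemma Profile.contDiff_funnelCutoff (H : Profile h) (ε : ℝ) :
    ContDiff ℝ 1 (funnelCutoff (d := d) h ε) :=
  (Real.smoothTransition.contDiff (n := 1)).comp
    ((contDiff_const.mul (H.contDiff_funnelFun.of_le (by norm_num))).sub contDiff_const)

lemma Profile.fderiv_funnelCutoff (H : Profile h) (ε : ℝ) (x v : Euc d) :
    fderiv ℝ (funnelCutoff h ε) x v =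
      deriv Real.smoothTransition (ε⁻¹ * funnelFun h x - 1) * ε⁻¹
        * (-2 * ∑ i, outNormal h x i * v i) := by
  have h1 := ((H.contDiff_funnelFun (d := d)).differentiable (by norm_num) x).hasFDerivAt
  have h2 := ((Real.smoothTransition.contDiff (n := 1)).differentiable (by norm_num)
    (ε⁻¹ * funnelFun h x - 1)).hasDerivAt.comp_hasFDerivAt x ((h1.const_mul ε⁻¹).sub_const 1)
  have h3 : fderiv ℝ (funnelCutoff h ε) x = _ := h2.fderiv
  rw [h3]
  simp only [smul_apply, smul_eq_mul, H.fderiv_funnelFun]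
  ring

/-- A pointwise version of Green's inequality, before integration: the divergence of a suitable
compactly supported field dominates the integrand. -/
lemma Profile.integral_cutoff_lapW_nonpos (H : Profile h) {w : Euc d → ℝ}
    (hw : ContDiffOn ℝ 2 w (closure (funnel d h))) {K : Set (Euc d)} (hK : IsCompact K)
    (hsupp : ∀ x ∈ funnel d h, x ∉ K → w x ≤ 0) {ε : ℝ} (hε : 0 < ε)
    (hn : ∀ x ∈ funnel d h, x ∈ K → funnelFun h x ≤ 2 * ε → normalDeriv h w x ≤ 0)
    (hcut : IntegrableOn (fun x => funnelCutoff h ε x *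
      (max (w x) 0 ^ 2 * lapW (closure (funnel d h)) w x)) (funnel d h)) :
    ∫ x in funnel d h, funnelCutoff h ε x *
      (max (w x) 0 ^ 2 * lapW (closure (funnel d h)) w x) ≤ 0 := by
  set D := closure (funnel d h) with hD
  have hΩo := H.isOpen_funnel (d := d)
  have hDn : ∀ x ∈ funnel d h, D ∈ 𝓝 x := fun x hx =>
    mem_of_superset (hΩo.mem_nhds hx) subset_closure
  set P : Fin (d + 1) → Euc d → ℝ := fun i y =>
    fderivWithin ℝ w D y (EuclideanSpace.single i 1) with hP
  have hP1 : ∀ i, ContDiffOn ℝ 1 (P i) D := fun i => hw.partialWithin H.uniqueDiffOn _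
  set V : Fin (d + 1) → Euc d → ℝ := fun i y => funnelCutoff h ε y * (max (w y) 0 ^ 2 * P i y)
    with hVdef
  have hzero : ∀ x ∉ funnel d h, funnelFun h x < ε := fun x hx => by
    have := mt H.mem_funnel.2 hx
    linarith
  have hV0 : ∀ i x, x ∉ funnel d h → V i =ᶠ[𝓝 x] fun _ => 0 := by
    intro i x hx
    filter_upwards [(isOpen_lt (H.contDiff_funnelFun (d := d)).continuous
      continuous_const).mem_nhds (hzero x hx)] with y hy
    simp [V, funnelCutoff_eq_zero hε (le_of_lt hy)]
  have hVΩ : ∀ i, ∀ x ∈ funnel d h, ContDiffAt ℝ 1 (V i) x := by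
    intro i x hx
    refine (H.contDiff_funnelCutoff ε).contDiffAt.mul (ContDiffAt.mul ?_ ?_)
    · exact contDiff_max_zero_sq.contDiffAt.comp x
        ((hw.contDiffAt (hDn x hx)).of_le (by norm_num))
    · exact (hP1 i).contDiffAt (hDn x hx)
  have hV : ∀ i, ContDiff ℝ 1 (V i) := by
    intro i
    rw [contDiff_iff_contDiffAt]
    intro x
    by_cases hx : x ∈ funnel d h
    · exact hVΩ i x hx
    · exact contDiffAt_const.congr_of_eventuallyEq (hV0 i x hx)
  have hVc : ∀ i, HasCompactSupport (V i) := by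
    intro i
    refine HasCompactSupport.of_support_subset_isCompact hK fun x hx => ?_
    by_contra hxK
    apply hx
    by_cases hxΩ : x ∈ funnel d h
    · simp [V, max_eq_right (hsupp x hxΩ hxK)]
    · exact (hV0 i x hxΩ).self_of_nhds
  have hdint : ∀ i, Integrable (fun x => fderiv ℝ (V i) x (EuclideanSpace.single i 1)) :=
    fun i => ((hV i).continuous_fderiv_apply (by norm_num) |>.comp
      (Continuous.prodMk continuous_id continuous_const)).integrable_of_hasCompactSupport
      ((hVc i).fderiv_apply ℝ _)
  have hsum : ∫ x, ∑ i, fderiv ℝ (V i) x (EuclideanSpace.single i 1) = 0 := by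
    rw [integral_finsetSum _ fun i _ => hdint i]
    exact Finset.sum_eq_zero fun i _ => integral_fderiv_apply_eq_zero (hV i) (hVc i) _
  have hout : ∀ x ∉ funnel d h, ∑ i, fderiv ℝ (V i) x (EuclideanSpace.single i 1) = 0 := by
    intro x hx
    refine Finset.sum_eq_zero fun i _ => ?_
    rw [(hV0 i x hx).fderiv_eq]
    simp
  rw [← setIntegral_eq_integral_of_forall_compl_eq_zero hout] at hsum
  refine (setIntegral_mono_on hcut (integrable_finsetSum _ fun i _ => hdint i).integrableOn
    hΩo.measurableSet fun x hx => ?_).trans hsum.le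
  -- the pointwise inequality
  have hwd : HasFDerivAt w (fderivWithin ℝ w D x) x :=
    ((hw.differentiableOn (by norm_num)) x (subset_closure hx)).hasFDerivWithinAt.hasFDerivAt
      (hDn x hx)
  have hdV : ∀ i, fderiv ℝ (V i) x (EuclideanSpace.single i 1) =
      deriv Real.smoothTransition (ε⁻¹ * funnelFun h x - 1) * ε⁻¹ * (-2 * outNormal h x i)
          * (max (w x) 0 ^ 2 * P i x)
        + funnelCutoff h ε x * (2 * max (w x) 0 * P i x ^ 2
          + max (w x) 0 ^ 2 * fderivWithin ℝ (P i) D x (EuclideanSpace.single i 1)) := by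
    intro i
    have h1 := ((H.contDiff_funnelCutoff (d := d) ε).differentiable (by norm_num) x).hasFDerivAt
    have h2 := (hasDerivAt_max_zero_pow 0 (w x)).comp_hasFDerivAt x hwd
    have h3 : HasFDerivAt (P i) (fderivWithin ℝ (P i) D x) x :=
      (((hP1 i).differentiableOn (by norm_num)) x
        (subset_closure hx)).hasFDerivWithinAt.hasFDerivAt (hDn x hx)
    have h4 : fderiv ℝ (V i) x = _ := (h1.mul (h2.mul h3)).fderiv
    rw [h4]
    simp [H.fderiv_funnelCutoff, P]
    ring
  have hnd : normalDeriv h w x = ∑ i, outNormal h x i * P i x :=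
    clm_apply_eq_sum _ _
  have hlap : lapW D w x = ∑ i, fderivWithin ℝ (P i) D x (EuclideanSpace.single i 1) := rfl
  have htot : ∑ i, fderiv ℝ (V i) x (EuclideanSpace.single i 1) =
      deriv Real.smoothTransition (ε⁻¹ * funnelFun h x - 1) * ε⁻¹ * max (w x) 0 ^ 2
          * (-2 * normalDeriv h w x)
        + funnelCutoff h ε x * (2 * max (w x) 0) * ∑ i, P i x ^ 2
        + funnelCutoff h ε x * (max (w x) 0 ^ 2 * lapW D w x) := by
    rw [Finset.sum_congr rfl fun i _ => hdV i, hnd, hlap]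
    simp only [Finset.mul_sum, ← Finset.sum_add_distrib]
    refine Finset.sum_congr rfl fun i _ => ?_
    ring
  rw [htot]
  have hc0 : 0 ≤ funnelCutoff h ε x := Real.smoothTransition.nonneg _
  have hm0 : 0 ≤ max (w x) 0 := le_max_right _ _
  have h1 : 0 ≤ funnelCutoff h ε x * (2 * max (w x) 0) * ∑ i, P i x ^ 2 := by
    have : 0 ≤ ∑ i, P i x ^ 2 := Finset.sum_nonneg fun i _ => sq_nonneg _
    positivity
  have h2 : 0 ≤ deriv Real.smoothTransition (ε⁻¹ * funnelFun h x - 1) * ε⁻¹ * max (w x) 0 ^ 2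
          * (-2 * normalDeriv h w x) := by
    have hd0 : 0 ≤ deriv Real.smoothTransition (ε⁻¹ * funnelFun h x - 1) :=
      smoothTransition_monotone.deriv_nonneg
    by_cases hxK : x ∈ K
    · by_cases hq : funnelFun h x ≤ 2 * ε
      · have := hn x hx hxK hq
        have h3 : 0 ≤ -2 * normalDeriv h w x := by linarith
        positivity
      · push Not at hq
        have : Real.smoothTransition =ᶠ[𝓝 (ε⁻¹ * funnelFun h x - 1)] fun _ => 1 := by
          have hlt : 1 < ε⁻¹ * funnelFun h x - 1 := by
            have : ε⁻¹ * (2 * ε) < ε⁻¹ * funnelFun h x := by gcongr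
            have h2 : ε⁻¹ * (2 * ε) = 2 := by field_simp
            linarith
          filter_upwards [lt_mem_nhds hlt] with s hs
          exact Real.smoothTransition.one_of_one_le hs.le
        rw [this.deriv_eq]
        simp
    · simp [max_eq_right (hsupp x hx hxK)]
  linarith

/-- Green's inequality: testing the Laplacian of `w` with an increasing function of the positive
part of `w`. -/
lemma Profile.integral_lapW_nonpos (H : Profile h) {w : Euc d → ℝ}
    (hw : ContDiffOn ℝ 2 w (closure (funnel d h))) {K : Set (Euc d)} (hK : IsCompact K)
    (hKD : K ⊆ closure (funnel d h)) (hsupp : ∀ x ∈ funnel d h, x ∉ K → w x ≤ 0)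
    (hn : ∀ x ∈ frontier (funnel d h), normalDeriv h w x ≤ 0) :
    ∫ x in funnel d h, max (w x) 0 ^ 2 * lapW (closure (funnel d h)) w x ≤ 0 := by
  set D := closure (funnel d h) with hD
  have hΩo := H.isOpen_funnel (d := d)
  have hU := H.uniqueDiffOn (d := d)
  have hs2 : ContDiffOn ℝ 2 (sqPrime (d := d)) D := contDiff_sqPrime.contDiffOn
  let δ : ℕ → ℝ := fun k => 1 / ((k : ℝ) + 1)
  have hδpos : ∀ k, 0 < δ k := fun k => by positivity
  have hδle : ∀ k, δ k ≤ 1 := fun k => by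
    simp only [δ]; rw [div_le_one (by positivity)]; linarith [(Nat.cast_nonneg k : (0 : ℝ) ≤ k)]
  have hδ0 : Tendsto δ atTop (𝓝 0) := tendsto_one_div_add_atTop_nhds_zero_nat
  let W : ℕ → Euc d → ℝ := fun k x => w x - δ k * sqPrime x
  have hW : ∀ k, ContDiffOn ℝ 2 (W k) D := fun k => hw.sub (contDiffOn_const.mul hs2)
  have hWle : ∀ k x, W k x ≤ w x := fun k x => by
    have := mul_nonneg (hδpos k).le (sqPrime_nonneg x)
    simp only [W]; linarith
  have hlapW : ∀ k, ∀ x ∈ D, lapW D (W k) x = lapW D w x - δ k * lapW D sqPrime x := by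
    intro k x hx
    rw [show W k = fun y => w y - δ k * sqPrime y from rfl,
      lapW_sub hU hw (contDiffOn_const.mul hs2) hx, lapW_const_mul hU hs2 _ hx]
  have hWn : ∀ k, ∀ x ∈ frontier (funnel d h), normalDeriv h (W k) x < 0 := by
    intro k x hx
    have hxD := (H.mem_frontier.1 hx).1
    rw [show W k = fun y => w y - δ k * sqPrime y from rfl,
      H.normalDeriv_sub hw (contDiffOn_const.mul hs2) hxD, H.normalDeriv_const_mul hs2 _ hxD]
    have := mul_pos (hδpos k) (H.normalDeriv_sqPrime_pos hx)
    linarith [hn x hx]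
  have hε : ∀ k, ∃ ε, 0 < ε ∧ ε ≤ δ k ∧
      ∀ x ∈ funnel d h, x ∈ K → funnelFun h x ≤ 2 * ε → normalDeriv h (W k) x ≤ 0 := by
    intro k
    set Z := K ∩ normalDeriv h (W k) ⁻¹' Ici 0 with hZ
    have hZc : IsCompact Z := by
      refine hK.of_isClosed_subset ?_ inter_subset_left
      exact ((H.continuousOn_normalDeriv (hW k)).mono hKD).preimage_isClosed_of_isClosed
        hK.isClosed isClosed_Ici
    rcases Z.eq_empty_or_nonempty with hZe | hZne
    · refine ⟨δ k, hδpos k, le_rfl, fun x _ hxK _ => ?_⟩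
      by_contra hc
      have : x ∈ Z := ⟨hxK, (not_le.1 hc).le⟩
      simp [hZe] at this
    · obtain ⟨y, hyZ, hy⟩ := hZc.exists_isMinOn hZne
        (H.contDiff_funnelFun (d := d)).continuous.continuousOn
      have hypos : 0 < funnelFun h y := by
        refine lt_of_le_of_ne (H.funnelFun_nonneg (hKD hyZ.1)) fun h0 => ?_
        exact absurd hyZ.2 (not_le.2 (hWn k y (H.mem_frontier.2 ⟨hKD hyZ.1, h0.symm⟩)))
      refine ⟨min (δ k) (funnelFun h y / 3), lt_min (hδpos k) (by positivity), min_le_left _ _,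
        fun x _ hxK hq => ?_⟩
      by_contra hc
      have h1 : funnelFun h y ≤ funnelFun h x := hy (show x ∈ Z from ⟨hxK, (not_le.1 hc).le⟩)
      have h2 := min_le_right (δ k) (funnelFun h y / 3)
      linarith
  choose ε hεpos hεδ hεn using hε
  -- bounds on the compact set
  have hwb : ∃ A, ∀ x ∈ K, w x ≤ A := by
    obtain ⟨A, hA⟩ := hK.bddAbove_image (hw.continuousOn.mono hKD)
    exact ⟨A, fun x hx => hA (mem_image_of_mem _ hx)⟩
  obtain ⟨A, hA⟩ := hwb
  obtain ⟨B, hB⟩ := hK.exists_bound_of_continuousOn ((continuousOn_lapW hU hw).mono hKD)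
  obtain ⟨B', hB'⟩ := hK.exists_bound_of_continuousOn ((continuousOn_lapW hU hs2).mono hKD)
  let F : ℕ → Euc d → ℝ := fun k x =>
    funnelCutoff h (ε k) x * (max (W k x) 0 ^ 2 * lapW D (W k) x)
  let bound : Euc d → ℝ := K.indicator fun _ => max A 0 ^ 2 * (B + B')
  have hbound : Integrable bound (volume.restrict (funnel d h)) :=
    ((integrable_indicator_iff hK.measurableSet).2
      (integrableOn_const (hK.measure_lt_top.ne))).integrableOn
  have hFb : ∀ k, ∀ x ∈ funnel d h, ‖F k x‖ ≤ bound x := by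
    intro k x hx
    by_cases hxK : x ∈ K
    · simp only [F, bound, indicator_of_mem hxK, norm_mul, norm_pow, Real.norm_eq_abs]
      have hc0 : 0 ≤ funnelCutoff h (ε k) x := Real.smoothTransition.nonneg _
      have hc1 : funnelCutoff h (ε k) x ≤ 1 := Real.smoothTransition.le_one _
      rw [abs_of_nonneg hc0, abs_of_nonneg (le_max_right _ _)]
      have h1 : max (W k x) 0 ^ 2 ≤ max A 0 ^ 2 := by
        have := (hWle k x).trans (hA x hxK)
        gcongr
      have h2 : |lapW D (W k) x| ≤ B + B' := by
        rw [hlapW k x (hKD hxK)]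
        refine (abs_sub _ _).trans ?_
        rw [abs_mul, abs_of_pos (hδpos k)]
        have h3 := hB x hxK
        have h4 := hB' x hxK
        rw [Real.norm_eq_abs] at h3 h4
        nlinarith [hδle k, abs_nonneg (lapW D sqPrime x)]
      calc funnelCutoff h (ε k) x * (max (W k x) 0 ^ 2 * |lapW D (W k) x|)
          ≤ 1 * (max A 0 ^ 2 * (B + B')) := by gcongr
        _ = _ := one_mul _
    · have : max (W k x) 0 = 0 := max_eq_right ((hWle k x).trans (hsupp x hx hxK))
      simp [F, bound, hxK, this]
  have hFm : ∀ k, AEStronglyMeasurable (F k) (volume.restrict (funnel d h)) := by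
    intro k
    refine ContinuousOn.aestronglyMeasurable ?_ hΩo.measurableSet
    refine (H.contDiff_funnelCutoff (ε k)).continuous.continuousOn.mul (ContinuousOn.mul ?_ ?_)
    · exact (((hW k).continuousOn.mono subset_closure).sup continuousOn_const).pow 2
    · exact (continuousOn_lapW hU (hW k)).mono subset_closure
  have hFint : ∀ k, IntegrableOn (F k) (funnel d h) := fun k =>
    hbound.mono' (hFm k) (ae_restrict_of_forall_mem hΩo.measurableSet (hFb k))
  have hFle : ∀ k, ∫ x in funnel d h, F k x ≤ 0 := fun k =>
    H.integral_cutoff_lapW_nonpos (hW k) hK (fun x hx hxK => (hWle k x).trans (hsupp x hx hxK))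
      (hεpos k) (hεn k) (hFint k)
  have hlim : Tendsto (fun k => ∫ x in funnel d h, F k x) atTop
      (𝓝 (∫ x in funnel d h, max (w x) 0 ^ 2 * lapW D w x)) := by
    refine tendsto_integral_of_dominated_convergence bound hFm hbound
      (fun k => ae_restrict_of_forall_mem hΩo.measurableSet (hFb k))
      (ae_restrict_of_forall_mem hΩo.measurableSet fun x hx => ?_)
    have hε0 : Tendsto ε atTop (𝓝 0) :=
      squeeze_zero (fun k => (hεpos k).le) hεδ hδ0
    have h1 : ∀ᶠ k in atTop, funnelCutoff h (ε k) x = 1 := by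
      have hq := H.mem_funnel.1 hx
      filter_upwards [hε0.eventually (gt_mem_nhds (show 0 < funnelFun h x / 2 by positivity))]
        with k hk
      exact funnelCutoff_eq_one (hεpos k) (by linarith)
    have h2 : Tendsto (fun k => W k x) atTop (𝓝 (w x)) := by
      simpa using (tendsto_const_nhds (x := w x)).sub (hδ0.mul_const (sqPrime x))
    have h3 : Tendsto (fun k => lapW D (W k) x) atTop (𝓝 (lapW D w x)) := by
      simp_rw [fun k => hlapW k x (subset_closure hx)]
      simpa using (tendsto_const_nhds (x := lapW D w x)).sub (hδ0.mul_const (lapW D sqPrime x))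
    have h4 := ((h2.max (tendsto_const_nhds (x := (0 : ℝ)))).pow 2).mul h3
    refine h4.congr' ?_
    filter_upwards [h1] with k hk
    simp [F, hk]
  exact le_of_tendsto' hlim hFle

end Green

/-- A continuous function with nonpositive upper right Dini derivative is nonincreasing. -/
lemma le_of_dini_right {E : ℝ → ℝ} {a b : ℝ} (hab : a ≤ b) (hE : ContinuousOn E (Icc a b))
    (hd : ∀ t ∈ Ico a b, ∀ ε > 0, ∀ᶠ τ in 𝓝[>] t, E τ ≤ E t + ε * (τ - t)) : E b ≤ E a := by
  refine image_le_of_liminf_slope_right_le_deriv_boundary (B := fun _ => E a)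
    (B' := fun _ => 0) hE le_rfl
    continuousOn_const (fun x _ => hasDerivWithinAt_const _ _ _) (fun t ht r hr => ?_)
    (right_mem_Icc.2 hab)
  refine Eventually.frequently ?_
  filter_upwards [hd t ht (r / 2) (half_pos hr), self_mem_nhdsWithin] with τ hτ hlt
  have hpos : 0 < τ - t := sub_pos.2 hlt
  rw [slope_def_field, div_lt_iff₀ hpos]
  nlinarith

/-- A function on an interval which does not increase on the gaps of a closed set, nor immediately
to the right of the points of this set, does not increase. -/
lemma le_of_forall_gap {p : ℝ → ℝ} {S : Set ℝ} {t τ : ℝ} (htτ : t ≤ τ) (hp : Continuous p)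
    (hS : IsClosed S) (ht : t ∈ S)
    (hloc : ∀ s ∈ S, s ∈ Ico t τ → ∀ᶠ s' in 𝓝[>] s, p s' ≤ p s)
    (hgap : ∀ a ∈ S, t ≤ a → ∀ b ∈ Ioc a τ, Disjoint (Ioo a b) S → p b ≤ p a) : p τ ≤ p t := by
  let Y : Set ℝ := {s | ∀ s' ∈ Ico t s, p s' ≤ p t}
  have hYc : IsClosed Y := by
    have : Y = ⋂ s' ∈ {s' | t ≤ s' ∧ p t < p s'}, Iic s' := by
      ext s
      simp only [Y, mem_ofPred_eq, mem_iInter, mem_Iic, mem_Ico]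
      refine ⟨fun H s' hs' => ?_, fun H s' hs' => ?_⟩
      · by_contra hc
        exact absurd (H s' ⟨hs'.1, not_le.1 hc⟩) (not_le.2 hs'.2)
      · by_contra hc
        exact absurd (H s' ⟨hs'.1, not_le.1 hc⟩) (not_le.2 hs'.2)
    rw [this]
    exact isClosed_biInter fun _ _ => isClosed_Iic
  have hY : ∀ s ∈ Y, t ≤ s → p s ≤ p t := by
    intro s hs hts
    rcases hts.eq_or_lt with rfl | hlt
    · exact le_rfl
    · refine le_of_tendsto (hp.continuousWithinAt (s := Iio s)) ?_
      filter_upwards [Ioo_mem_nhdsLT hlt] with s' hs'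
      exact hs s' ⟨hs'.1.le, hs'.2⟩
  refine hY τ ?_ htτ
  refine IsClosed.Icc_subset_of_forall_mem_nhdsWithin (hYc.inter isClosed_Icc)
    (fun s' hs' => absurd hs'.2 (not_lt.2 hs'.1)) ?_ (right_mem_Icc.2 htτ)
  intro s hs
  have hps := hY s hs.1 hs.2.1
  suffices hev : ∀ᶠ s' in 𝓝[>] s, p s' ≤ p t by
    obtain ⟨c, hc, hcs⟩ := (mem_nhdsGT_iff_exists_Ioo_subset).1 hev
    refine mem_of_superset (Ioo_mem_nhdsGT hc) fun s' hs' s'' hs'' => ?_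
    rcases lt_trichotomy s'' s with h | rfl | h
    · exact hs.1 s'' ⟨hs''.1, h⟩
    · exact hps
    · exact hcs ⟨h, hs''.2.trans hs'.2⟩
  by_cases hsS : s ∈ S
  · filter_upwards [hloc s hsS hs.2] with s' hs'
    exact hs'.trans hps
  · set a := sSup (S ∩ Icc t s) with ha
    have hne : (S ∩ Icc t s).Nonempty := ⟨t, ht, le_rfl, hs.2.1⟩
    have hbdd : BddAbove (S ∩ Icc t s) := ⟨s, fun x hx => hx.2.2⟩
    have haS : a ∈ S ∩ Icc t s := (hS.inter isClosed_Icc).csSup_mem hne hbdd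
    have has : a < s := lt_of_le_of_ne haS.2.2 fun h => hsS (h ▸ haS.1)
    have hpa : p a ≤ p t := hs.1 a ⟨haS.2.1, has⟩
    obtain ⟨c, hc, hcs⟩ := exists_Ico_subset_of_mem_nhds (hS.isOpen_compl.mem_nhds hsS)
      ⟨s + 1, lt_add_one s⟩
    filter_upwards [Ioo_mem_nhdsGT (lt_min hc hs.2.2)] with s' hs'
    refine (hgap a haS.1 haS.2.1 s' ⟨has.trans hs'.1, (hs'.2.trans_le (min_le_right _ _)).le⟩
      ?_).trans hpa
    rw [Set.disjoint_left]
    intro q hq hqS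
    rcases le_or_gt q s with h | h
    · exact absurd (le_csSup hbdd ⟨hqS, haS.2.1.trans hq.1.le, h⟩) (not_le.2 hq.1)
    · exact hcs ⟨h.le, hq.2.trans (hs'.2.trans_le (min_le_left _ _))⟩ hqS

lemma second_difference_le {k k₁ k₂ : ℝ → ℝ} {δ n : ℝ} (hδ : 0 < δ)
    (h1 : ∀ s ∈ Icc (-δ) δ, HasDerivAt k (k₁ s) s) (h2 : ∀ s ∈ Icc (-δ) δ, HasDerivAt k₁ (k₂ s) s)
    (hn : ∀ s ∈ Icc (-δ) δ, k₂ s ≤ n) : k δ + k (-δ) - 2 * k 0 ≤ n * δ ^ 2 := by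
  have hψ : ∀ s ∈ Icc 0 δ, HasDerivAt (fun s => k s + k (-s) - n * s ^ 2)
      (k₁ s - k₁ (-s) - 2 * n * s) s := by
    intro s hs
    have e1 := h1 s ⟨by linarith [hs.1], hs.2⟩
    have e2 := (h1 (-s) ⟨by linarith [hs.2], by linarith [hs.1]⟩).comp s (hasDerivAt_neg s)
    have e3 := (hasDerivAt_pow 2 s).const_mul n
    have e4 := (e1.add e2).sub e3
    refine HasDerivAt.congr_deriv e4 ?_
    norm_num
    ring
  obtain ⟨c, hc, hc'⟩ := exists_hasDerivAt_eq_slope _ _ hδ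
    (fun s hs => (hψ s hs).continuousAt.continuousWithinAt)
    (fun s hs => hψ s (Ioo_subset_Icc_self hs))
  obtain ⟨e, he, he'⟩ := exists_hasDerivAt_eq_slope k₁ k₂ (show -c < c by linarith [hc.1])
    (fun s hs => (h2 s ⟨by linarith [hs.1, hc.2],
      by linarith [hs.2, hc.2]⟩).continuousAt.continuousWithinAt)
    (fun s hs => h2 s ⟨by linarith [hs.1, hc.2], by linarith [hs.2, hc.2]⟩)
  have h3 := hn e ⟨by linarith [he.1, hc.2], by linarith [he.2, hc.2]⟩
  rw [eq_div_iff (by linarith [hc.1])] at he'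
  rw [eq_div_iff (by linarith)] at hc'
  simp only [neg_zero] at hc'
  have h4 : k₁ c - k₁ (-c) - 2 * n * c ≤ 0 := by nlinarith [hc.1]
  nlinarith

lemma le_of_second_difference {k k₁ k₂ : ℝ → ℝ} {n : ℝ}
    (h1 : ∀ᶠ s in 𝓝 0, HasDerivAt k (k₁ s) s) (h2 : ∀ᶠ s in 𝓝 0, HasDerivAt k₁ (k₂ s) s)
    (hc : ContinuousAt k₂ 0)
    (hn : ∀ᶠ δ in 𝓝[>] 0, k δ + k (-δ) - 2 * k 0 ≤ n * δ ^ 2) : k₂ 0 ≤ n := by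
  by_contra hlt
  push Not at hlt
  obtain ⟨n', hn1, hn2⟩ := exists_between hlt
  obtain ⟨r, hr, hr'⟩ := Metric.eventually_nhds_iff.1
    (h1.and (h2.and (hc.eventually (lt_mem_nhds hn2))))
  obtain ⟨δ, hδ, hδr⟩ := (hn.and (Ioo_mem_nhdsGT hr)).exists
  have key : ∀ s ∈ Icc (-δ) δ, dist s 0 < r := fun s hs => by
    rw [Real.dist_0_eq_abs]
    exact (abs_le.2 hs).trans_lt hδr.2
  have := second_difference_le (k := fun s => - k s) (k₁ := fun s => - k₁ s) (k₂ := fun s => - k₂ s)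
    (n := -n') hδr.1 (fun s hs => (hr' (key s hs)).1.neg) (fun s hs => (hr' (key s hs)).2.1.neg)
    (fun s hs => by linarith [(hr' (key s hs)).2.2])
  have hδ2 : 0 < δ ^ 2 := pow_pos hδr.1 2
  nlinarith

/-- A locally bounded solution of `v_t = Δv + g` with Neumann boundary condition in the funnel. -/
structure Evolution {d : ℕ} (h : ℝ → ℝ) (v g : ℝ → Euc d → ℝ) : Prop where
  bdd : ∀ T : ℝ, ∃ M : ℝ, ∀ t, |t| ≤ T → ∀ x ∈ funnel d h, |v t x| ≤ M ∧ g t x ≤ M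
  diff : ∀ x ∈ funnel d h, Differentiable ℝ fun t => v t x
  reg : ∀ t, ContDiffOn ℝ 2 (v t) (closure (funnel d h))
  pde : ∀ t, ∀ x ∈ funnel d h,
    deriv (fun s => v s x) t = lapW (closure (funnel d h)) (v t) x + g t x
  neu : ∀ t, ∀ x ∈ frontier (funnel d h), normalDeriv h (v t) x = 0

/-- A smooth exhaustion function of the closed funnel, nondecreasing along the outward normal. -/
structure Exhaustion {d : ℕ} (h : ℝ → ℝ) (ρ : Euc d → ℝ) : Prop where
  smooth : ContDiff ℝ 2 ρ
  compact : ∀ r : ℝ, IsCompact (closure (funnel d h) ∩ {x | ρ x ≤ r})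
  neu : ∀ x ∈ frontier (funnel d h), 0 ≤ normalDeriv h ρ x

/-- A supersolution `z` on the time interval `(a,b)` wherever it is exceeded by `v`, which dominates
`v` outside the sublevel set `{ρ ≤ r}`. -/
structure Barrier {d : ℕ} (h : ℝ → ℝ) (ρ : Euc d → ℝ) (v g z : ℝ → Euc d → ℝ) (a b r : ℝ) :
    Prop where
  reg : ∀ t ∈ Ioo a b, ContDiffOn ℝ 2 (z t) (closure (funnel d h))
  diff : ∀ t ∈ Ioo a b, ∀ x ∈ funnel d h, DifferentiableAt ℝ (fun s => z s x) t
  lower : ∃ C : ℝ, ∀ t ∈ Ioo a b, ∀ x ∈ funnel d h, -C ≤ z t x ∧ -C ≤ deriv (fun s => z s x) t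
  neu : ∀ t ∈ Ioo a b, ∀ x ∈ frontier (funnel d h), 0 ≤ normalDeriv h (z t) x
  outside : ∀ t ∈ Ioo a b, ∀ x ∈ funnel d h, r < ρ x → v t x ≤ z t x
  super : ∀ t ∈ Ioo a b, ∀ x ∈ funnel d h, z t x < v t x →
    lapW (closure (funnel d h)) (z t) x + g t x ≤ deriv (fun s => z s x) t

/-- The integral over the funnel of the cube of the positive part. -/
def posEnergy {d : ℕ} (h : ℝ → ℝ) (w : Euc d → ℝ) : ℝ := ∫ x in funnel d h, max (w x) 0 ^ 3

section

variable {d : ℕ} {h : ℝ → ℝ} {ρ : Euc d → ℝ} {v g z : ℝ → Euc d → ℝ} {a b r : ℝ}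

lemma Barrier.mono {a' b' r' : ℝ} (Z : Barrier h ρ v g z a b r) (ha : a ≤ a') (hb : b' ≤ b)
    (hr : r ≤ r') : Barrier h ρ v g z a' b' r' := by
  have hs : Ioo a' b' ⊆ Ioo a b := Ioo_subset_Ioo ha hb
  obtain ⟨C, hC⟩ := Z.lower
  exact ⟨fun t ht => Z.reg t (hs ht), fun t ht => Z.diff t (hs ht),
    ⟨C, fun t ht => hC t (hs ht)⟩, fun t ht => Z.neu t (hs ht),
    fun t ht x hx hρ => Z.outside t (hs ht) x hx (hr.trans_lt hρ),
    fun t ht => Z.super t (hs ht)⟩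

lemma Profile.integrable_indicator_const (K : Set (Euc d)) (hK : IsCompact K) (A : ℝ) :
    Integrable (K.indicator fun _ => A) (volume.restrict (funnel d h)) :=
  ((integrable_indicator_iff hK.measurableSet).2
      (integrableOn_const (hK.measure_lt_top.ne))).integrableOn

lemma cube_sub_cube_le {x y A e : ℝ} (hx : 0 ≤ x) (hy : 0 ≤ y) (hxA : x ≤ A) (hyA : y ≤ A)
    (he : 0 ≤ e) (hxy : x - y ≤ e) : x ^ 3 - y ^ 3 ≤ 3 * A ^ 2 * e := by
  have h1 : x ^ 2 + x * y + y ^ 2 ≤ 3 * A ^ 2 := by nlinarith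
  calc x ^ 3 - y ^ 3 = (x - y) * (x ^ 2 + x * y + y ^ 2) := by ring
    _ ≤ e * (x ^ 2 + x * y + y ^ 2) := by gcongr
    _ ≤ e * (3 * A ^ 2) := by gcongr
    _ = _ := by ring

lemma norm_max_zero_cube_le {s A : ℝ} (hs : s ≤ A) : ‖max s 0 ^ 3‖ ≤ max A 0 ^ 3 := by
  rw [norm_pow, Real.norm_of_nonneg (le_max_right _ _)]
  gcongr

lemma Profile.integrableOn_max_cube (H : Profile h) {w : Euc d → ℝ} {K : Set (Euc d)}
    (hK : IsCompact K) {A : ℝ} (hw : ContinuousOn w (funnel d h)) (hA : ∀ x ∈ funnel d h, w x ≤ A)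
    (hKw : ∀ x ∈ funnel d h, x ∉ K → w x ≤ 0) :
    IntegrableOn (fun x => max (w x) 0 ^ 3) (funnel d h) := by
  refine (Profile.integrable_indicator_const K hK (max A 0 ^ 3)).mono'
    (((hw.sup continuousOn_const).pow 3).aestronglyMeasurable H.isOpen_funnel.measurableSet)
    (ae_restrict_of_forall_mem H.isOpen_funnel.measurableSet fun x hx => ?_)
  by_cases hxK : x ∈ K
  · rw [indicator_of_mem hxK]
    exact norm_max_zero_cube_le (hA x hx)
  · simp [hxK, max_eq_right (hKw x hx hxK)]

lemma Profile.tendsto_posEnergy (H : Profile h) {l : Filter ℝ} [l.IsCountablyGenerated]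
    {w : ℝ → Euc d → ℝ} {w₀ : Euc d → ℝ} {K : Set (Euc d)} (hK : IsCompact K) {A : ℝ}
    (hw : ∀ᶠ t in l, ContinuousOn (w t) (funnel d h) ∧
      (∀ x ∈ funnel d h, w t x ≤ A) ∧ ∀ x ∈ funnel d h, x ∉ K → w t x ≤ 0)
    (hlim : ∀ x ∈ funnel d h, Tendsto (fun t => w t x) l (𝓝 (w₀ x))) :
    Tendsto (fun t => posEnergy h (w t)) l (𝓝 (posEnergy h w₀)) := by
  have hΩ := (H.isOpen_funnel (d := d)).measurableSet
  refine tendsto_integral_filter_of_dominated_convergence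
    (K.indicator fun _ => max A 0 ^ 3) ?_ ?_ (Profile.integrable_indicator_const K hK _) ?_
  · filter_upwards [hw] with t ht
    exact ((ht.1.sup continuousOn_const).pow 3).aestronglyMeasurable hΩ
  · filter_upwards [hw] with t ht
    refine ae_restrict_of_forall_mem hΩ fun x hx => ?_
    by_cases hxK : x ∈ K
    · rw [indicator_of_mem hxK]
      exact norm_max_zero_cube_le (ht.2.1 x hx)
    · simp [hxK, max_eq_right (ht.2.2 x hx hxK)]
  · exact ae_restrict_of_forall_mem hΩ fun x hx =>
      ((hlim x hx).max tendsto_const_nhds).pow 3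

lemma Profile.nonpos_of_posEnergy_le (H : Profile h) {w : Euc d → ℝ} {K : Set (Euc d)}
    (hK : IsCompact K) {A : ℝ} (hw : ContinuousOn w (funnel d h)) (hA : ∀ x ∈ funnel d h, w x ≤ A)
    (hKw : ∀ x ∈ funnel d h, x ∉ K → w x ≤ 0) (hE : posEnergy h w ≤ 0) :
    ∀ x ∈ funnel d h, w x ≤ 0 := by
  have hnn : ∀ x, 0 ≤ max (w x) 0 ^ 3 := fun x => by positivity
  have h0 : posEnergy h w = 0 := le_antisymm hE (integral_nonneg hnn)
  have hae := (integral_eq_zero_iff_of_nonneg hnn (H.integrableOn_max_cube hK hw hA hKw)).1 h0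
  have := Measure.eqOn_open_of_ae_eq hae H.isOpen_funnel ((hw.sup continuousOn_const).pow 3)
    continuousOn_const
  intro x hx
  have h1 : max (w x) 0 ^ 3 = 0 := this hx
  exact max_eq_right_iff.1 (pow_eq_zero_iff (by norm_num) |>.1 h1)

/-- The control on `v - z` needed to integrate the positive part. -/
lemma Barrier.control (V : Evolution h v g) (Z : Barrier h ρ v g z a b r) :
    ∃ A, 0 ≤ A ∧ ∀ t ∈ Ioo a b, ContinuousOn (fun x => v t x - z t x) (funnel d h) ∧
      (∀ x ∈ funnel d h, v t x - z t x ≤ A) ∧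
      ∀ x ∈ funnel d h, x ∉ closure (funnel d h) ∩ {x | ρ x ≤ r} → v t x - z t x ≤ 0 := by
  obtain ⟨C, hC⟩ := Z.lower
  obtain ⟨M, hM⟩ := V.bdd (max |a| |b|)
  refine ⟨max (M + C) 0, le_max_right _ _, fun t ht => ⟨?_, fun x hx => ?_, fun x hx hxK => ?_⟩⟩
  · exact ((V.reg t).sub (Z.reg t ht)).continuousOn.mono subset_closure
  · have h1 := (hM t (abs_le_max_abs_abs ht.1.le ht.2.le) x hx).1
    have h2 := (hC t ht x hx).1
    exact le_max_of_le_left (by linarith [le_abs_self (v t x)])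
  · have : r < ρ x := by
      by_contra hc
      exact hxK ⟨subset_closure hx, not_lt.1 hc⟩
    linarith [Z.outside t ht x hx this]

lemma Barrier.continuousOn_energy (H : Profile h) (X : Exhaustion h ρ) (V : Evolution h v g)
    (Z : Barrier h ρ v g z a b r) :
    ContinuousOn (fun t => posEnergy h fun x => v t x - z t x) (Ioo a b) := by
  obtain ⟨A, -, hA⟩ := Z.control V
  intro t ht
  refine ContinuousAt.continuousWithinAt ?_
  refine H.tendsto_posEnergy (X.compact r) (A := A) ?_ fun x hx =>
    ((V.diff x hx t).continuousAt.sub (Z.diff t ht x hx).continuousAt)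
  filter_upwards [isOpen_Ioo.mem_nhds ht] with s hs using hA s hs

/-- The right Dini derivative of the energy is nonpositive at a time from which `v` grows at most
linearly. -/
lemma Barrier.energy_dini (H : Profile h) (X : Exhaustion h ρ) (V : Evolution h v g)
    (Z : Barrier h ρ v g z a b r) {t : ℝ} (ht : t ∈ Ioo a b) {C : ℝ}
    (hC : ∀ᶠ τ in 𝓝[>] t, ∀ x ∈ funnel d h, ρ x ≤ r → v τ x ≤ v t x + C * (τ - t))
    {ε : ℝ} (hε : 0 < ε) :
    ∀ᶠ τ in 𝓝[>] t, (posEnergy h fun x => v τ x - z τ x)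
      ≤ (posEnergy h fun x => v t x - z t x) + ε * (τ - t) := by
  set D := closure (funnel d h) with hD
  set K := D ∩ {x | ρ x ≤ r} with hKdef
  have hK : IsCompact K := X.compact r
  have hΩ := (H.isOpen_funnel (d := d)).measurableSet
  have hU := H.uniqueDiffOn (d := d)
  obtain ⟨A, hA0, hA⟩ := Z.control V
  obtain ⟨Cz, hCz⟩ := Z.lower
  let w : ℝ → Euc d → ℝ := fun s x => v s x - z s x
  have hwreg : ContDiffOn ℝ 2 (w t) D := (V.reg t).sub (Z.reg t ht)
  let p : Euc d → ℝ := fun x => 3 * (max (w t x) 0 ^ 2 * lapW D (w t) x)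
  have hpcont : ContinuousOn p D :=
    continuousOn_const.mul (((hwreg.continuousOn.sup continuousOn_const).pow 2).mul
      (continuousOn_lapW hU hwreg))
  have hp0 : ∀ x ∈ funnel d h, x ∉ K → p x = 0 := fun x hx hxK => by
    have : max (w t x) 0 = 0 := max_eq_right ((hA t ht).2.2 x hx hxK)
    simp [p, this]
  have hpint : ∫ x in funnel d h, p x ≤ 0 := by
    have := H.integral_lapW_nonpos hwreg hK inter_subset_left (hA t ht).2.2 (fun x hx => by
      have hxD := (H.mem_frontier.1 hx).1
      rw [show w t = fun y => v t y - z t y from rfl,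
        H.normalDeriv_sub (V.reg t) (Z.reg t ht) hxD, V.neu t x hx]
      linarith [Z.neu t ht x hx])
    simp only [p]
    rw [integral_const_mul]
    linarith
  obtain ⟨B, hB⟩ := hK.exists_bound_of_continuousOn (hpcont.mono inter_subset_left)
  let Q : ℝ → Euc d → ℝ := fun τ x => (max (w τ x) 0 ^ 3 - max (w t x) 0 ^ 3) / (τ - t)
  let F : ℝ → Euc d → ℝ := fun τ x => max (Q τ x) (p x)
  let C₁ : ℝ := max (C + Cz) 0
  -- upper bound on the difference quotients
  have hQ : ∀ᶠ τ in 𝓝[>] t, ∀ x ∈ funnel d h, x ∈ K → Q τ x ≤ 3 * A ^ 2 * C₁ := by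
    filter_upwards [hC, Ioo_mem_nhdsGT ht.2] with τ hτ hτt x hx hxK
    have hpos : 0 < τ - t := sub_pos.2 hτt.1
    have hsub : Icc t τ ⊆ Ioo a b := fun s hs => ⟨ht.1.trans_le hs.1, hs.2.trans_lt hτt.2⟩
    have hz : -Cz * (τ - t) ≤ z τ x - z t x := by
      refine (convex_Icc t τ).mul_sub_le_image_sub_of_le_deriv (f := fun s => z s x)
        (fun s hs => (Z.diff s (hsub hs) x hx).continuousAt.continuousWithinAt)
        (fun s hs => (Z.diff s (hsub (interior_subset hs)) x hx).differentiableWithinAt)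
        (fun s hs => (hCz s (hsub (interior_subset hs)) x hx).2) t (left_mem_Icc.2 hτt.1.le) τ
        (right_mem_Icc.2 hτt.1.le) hτt.1.le
    have hv := hτ x hx hxK.2
    have h1 : w τ x - w t x ≤ C₁ * (τ - t) := by
      have : (C + Cz) * (τ - t) ≤ C₁ * (τ - t) := by gcongr; exact le_max_left _ _
      simp only [w]; linarith
    have hC1 : 0 ≤ C₁ := le_max_right _ _
    have ha1 : max (w τ x) 0 ≤ A := max_le ((hA τ ⟨ht.1.trans hτt.1, hτt.2⟩).2.1 x hx) hA0
    have ha2 : max (w t x) 0 ≤ A := max_le ((hA t ht).2.1 x hx) hA0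
    have h2 : max (w τ x) 0 - max (w t x) 0 ≤ C₁ * (τ - t) := by
      have h3 : 0 ≤ C₁ * (τ - t) := by positivity
      have h4 : w t x ≤ max (w t x) 0 := le_max_left _ _
      have h5 : 0 ≤ max (w t x) 0 := le_max_right _ _
      rw [sub_le_iff_le_add]
      exact max_le (by linarith) (by linarith)
    rw [div_le_iff₀ hpos]
    have := cube_sub_cube_le (le_max_right (w τ x) 0) (le_max_right (w t x) 0) ha1 ha2
      (by positivity) h2
    linarith
  have hF : ∀ᶠ τ in 𝓝[>] t, ∀ x ∈ funnel d h,
      ‖F τ x‖ ≤ K.indicator (fun _ => max (3 * A ^ 2 * C₁) B) x := by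
    filter_upwards [hQ, Ioo_mem_nhdsGT ht.2] with τ hτ hτt x hx
    by_cases hxK : x ∈ K
    · rw [indicator_of_mem hxK]
      have h1 := hB x hxK
      rw [Real.norm_eq_abs, abs_le] at h1 ⊢
      refine ⟨?_, max_le_max (hτ x hx hxK) h1.2⟩
      calc -max (3 * A ^ 2 * C₁) B ≤ -B := neg_le_neg (le_max_right _ _)
        _ ≤ p x := h1.1
        _ ≤ _ := le_max_right _ _
    · have h1 : max (w t x) 0 = 0 := max_eq_right ((hA t ht).2.2 x hx hxK)
      have h2 : max (w τ x) 0 = 0 :=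
        max_eq_right ((hA τ ⟨ht.1.trans hτt.1, hτt.2⟩).2.2 x hx hxK)
      simp [F, Q, hxK, h1, h2, hp0 x hx hxK]
  have hQc : ∀ᶠ τ in 𝓝[>] t, ContinuousOn (Q τ) (funnel d h) := by
    filter_upwards [Ioo_mem_nhdsGT ht.2] with τ hτt
    exact ((((hA τ ⟨ht.1.trans hτt.1, hτt.2⟩).1.sup continuousOn_const).pow 3).sub
      (((hA t ht).1.sup continuousOn_const).pow 3)).div_const _
  have hFm : ∀ᶠ τ in 𝓝[>] t, AEStronglyMeasurable (F τ) (volume.restrict (funnel d h)) := by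
    filter_upwards [hQc] with τ hτ
    exact (hτ.sup (hpcont.mono subset_closure)).aestronglyMeasurable hΩ
  have hlim : ∀ x ∈ funnel d h, Tendsto (fun τ => F τ x) (𝓝[>] t) (𝓝 (p x)) := by
    intro x hx
    have hwd : HasDerivAt (fun s => w s x)
        (deriv (fun s => v s x) t - deriv (fun s => z s x) t) t :=
      (V.diff x hx t).hasDerivAt.sub (Z.diff t ht x hx).hasDerivAt
    have hcd := (hasDerivAt_max_zero_pow 1 (w t x)).comp t hwd
    have hslope := hcd.tendsto_slope.mono_left (nhdsWithin_mono t fun s (hs : t < s) => hs.ne')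
    set q := ((1 : ℕ) + 2 : ℝ) * max (w t x) 0 ^ (1 + 1)
      * (deriv (fun s => v s x) t - deriv (fun s => z s x) t) with hq
    have hqp : q ≤ p x := by
      rcases le_or_gt (w t x) 0 with hneg | hpos
      · simp [q, p, max_eq_right hneg]
      · have hsup := Z.super t ht x hx (by simpa [w] using hpos)
        have hlap : lapW D (w t) x = lapW D (v t) x - lapW D (z t) x :=
          lapW_sub hU (V.reg t) (Z.reg t ht) (subset_closure hx)
        have hle : deriv (fun s => v s x) t - deriv (fun s => z s x) t ≤ lapW D (w t) x := by
          rw [hlap, V.pde t x hx]; linarith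
        simp only [q, p]
        have h3 : (0 : ℝ) ≤ 3 * max (w t x) 0 ^ 2 := by positivity
        have := mul_le_mul_of_nonneg_left hle h3
        norm_num
        linarith
    have h1 : Tendsto (fun τ => Q τ x) (𝓝[>] t) (𝓝 q) := by
      refine hslope.congr fun τ => ?_
      rw [slope_def_field]
      simp [Q]
    simpa [F, max_eq_right hqp] using h1.max (tendsto_const_nhds (x := p x))
  have hFlim := tendsto_integral_filter_of_dominated_convergence
    (μ := volume.restrict (funnel d h)) (K.indicator fun _ => max (3 * A ^ 2 * C₁) B) hFm
    (hF.mono fun τ hτ => ae_restrict_of_forall_mem hΩ hτ)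
    (Profile.integrable_indicator_const K hK _) (ae_restrict_of_forall_mem hΩ hlim)
  filter_upwards [hFlim.eventually (gt_mem_nhds (hpint.trans_lt hε)), hF, hFm,
    Ioo_mem_nhdsGT ht.2] with τ h1 h2 h3 hτt
  have hpos : 0 < τ - t := sub_pos.2 hτt.1
  have hτab : τ ∈ Ioo a b := ⟨ht.1.trans hτt.1, hτt.2⟩
  have hFint : IntegrableOn (F τ) (funnel d h) :=
    (Profile.integrable_indicator_const K hK _).mono' h3 (ae_restrict_of_forall_mem hΩ h2)
  have i1 := H.integrableOn_max_cube hK (hA τ hτab).1 (hA τ hτab).2.1 (hA τ hτab).2.2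
  have i2 := H.integrableOn_max_cube hK (hA t ht).1 (hA t ht).2.1 (hA t ht).2.2
  have hQint : IntegrableOn (Q τ) (funnel d h) := (i1.sub i2).div_const _
  have h4 : ∫ x in funnel d h, Q τ x ≤ ∫ x in funnel d h, F τ x :=
    setIntegral_mono_on hQint hFint hΩ fun x _ => le_max_left _ _
  have h5 : ∫ x in funnel d h, Q τ x = ((posEnergy h fun x => v τ x - z τ x)
      - posEnergy h fun x => v t x - z t x) / (τ - t) := by
    simp only [Q]
    rw [integral_div, integral_sub i1 i2]
    rfl
  have h6 := (h5 ▸ h4).trans h1.le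
  rw [div_le_iff₀ hpos] at h6
  linarith

end

/-- The energy of `v - z` is nonincreasing for all barriers `z` of radius `r` on time intervals
contained in `I`. -/
def ComparableOn {d : ℕ} (h : ℝ → ℝ) (ρ : Euc d → ℝ) (v g : ℝ → Euc d → ℝ) (I : Set ℝ) (r : ℝ) :
    Prop :=
  ∀ (a b : ℝ) (z : ℝ → Euc d → ℝ), Ioo a b ⊆ I → Barrier h ρ v g z a b r →
    AntitoneOn (fun t => posEnergy h fun x => v t x - z t x) (Ioo a b)

/-- The comparison principle holds near the time `t` and for radii near `r`. -/
def ComparableAt {d : ℕ} (h : ℝ → ℝ) (ρ : Euc d → ℝ) (v g : ℝ → Euc d → ℝ) (t r : ℝ) : Prop :=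
  ∃ δ > 0, ComparableOn h ρ v g (Ioo (t - δ) (t + δ)) (r + δ)

/-- The times at which the pure second differences of `v` in `{ρ < m}` are bounded by `n`. -/
def secondDiffSet {d : ℕ} (h : ℝ → ℝ) (ρ : Euc d → ℝ) (v : ℝ → Euc d → ℝ) (n m : ℝ) : Set ℝ :=
  {t | ∀ (i : Fin (d + 1)) (x : Euc d) (δ : ℝ), 0 < δ →
    (∀ s ∈ Icc (-δ) δ, x + s • EuclideanSpace.single i 1 ∈ funnel d h ∧
      ρ (x + s • EuclideanSpace.single i 1) < m) →
    v t (x + δ • EuclideanSpace.single i 1) + v t (x + (-δ) • EuclideanSpace.single i 1)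
      - 2 * v t (x + (0 : ℝ) • EuclideanSpace.single i 1) ≤ n * δ ^ 2}

section

variable {d : ℕ} {h : ℝ → ℝ} {ρ : Euc d → ℝ} {v g z : ℝ → Euc d → ℝ} {a b r : ℝ}

lemma ComparableOn.mono {I I' : Set ℝ} {r' : ℝ} (hc : ComparableOn h ρ v g I r) (hI : I' ⊆ I)
    (hr : r' ≤ r) : ComparableOn h ρ v g I' r' :=
  fun a b z hab Z => hc a b z (hab.trans hI) (Z.mono le_rfl le_rfl hr)

lemma ComparableAt.mono {t r' : ℝ} (hc : ComparableAt h ρ v g t r) (hr : r' ≤ r) :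
    ComparableAt h ρ v g t r' := by
  obtain ⟨δ, hδ, hδc⟩ := hc
  exact ⟨δ, hδ, hδc.mono le_rfl (by linarith)⟩

lemma isOpen_comparableAt : IsOpen {p : ℝ × ℝ | ComparableAt h ρ v g p.1 p.2} := by
  rw [Metric.isOpen_iff]
  rintro ⟨t, r⟩ ⟨δ, hδ, hc⟩
  refine ⟨δ / 2, by positivity, fun p hp => ⟨δ / 2, by positivity, hc.mono ?_ ?_⟩⟩
  all_goals
    rw [Metric.mem_ball, Prod.dist_eq, max_lt_iff, Real.dist_eq, Real.dist_eq, abs_lt, abs_lt] at hp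
    simp only at hp ⊢
  · exact Ioo_subset_Ioo (by linarith [hp.1.1, hp.1.2]) (by linarith [hp.1.1, hp.1.2])
  · linarith [hp.2.1, hp.2.2]

lemma Barrier.antitoneOn_energy (H : Profile h) (X : Exhaustion h ρ) (V : Evolution h v g)
    (Z : Barrier h ρ v g z a b r)
    (hloc : ∀ t ∈ Ioo a b, ComparableAt h ρ v g t r ∨
      ∃ C : ℝ, ∀ᶠ τ in 𝓝[>] t, ∀ x ∈ funnel d h, ρ x ≤ r → v τ x ≤ v t x + C * (τ - t)) :
    AntitoneOn (fun t => posEnergy h fun x => v t x - z t x) (Ioo a b) := by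
  intro s hs t ht hst
  have hsub : Icc s t ⊆ Ioo a b := fun q hq => ⟨hs.1.trans_le hq.1, hq.2.trans_lt ht.2⟩
  refine le_of_dini_right hst ((Z.continuousOn_energy H X V).mono hsub) fun q hq ε hε => ?_
  have hqab := hsub (Ico_subset_Icc_self hq)
  rcases hloc q hqab with ⟨δ, hδ, hc⟩ | ⟨C, hC⟩
  · have hmem : q ∈ Ioo (max a (q - δ)) (min b (q + δ)) :=
      ⟨max_lt hqab.1 (by linarith), lt_min hqab.2 (by linarith)⟩
    have hanti := hc (max a (q - δ)) (min b (q + δ)) z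
      (Ioo_subset_Ioo (le_max_right _ _) (min_le_right _ _))
      (Z.mono (le_max_left _ _) (min_le_left _ _) (by linarith))
    filter_upwards [Ioo_mem_nhdsGT hmem.2] with τ hτ
    have h1 := hanti hmem ⟨hmem.1.trans hτ.1, hτ.2⟩ hτ.1.le
    have h2 : 0 ≤ ε * (τ - q) := mul_nonneg hε.le (sub_nonneg.2 hτ.1.le)
    simp only at h1
    linarith
  · exact Z.energy_dini H X V hqab hC hε

lemma Barrier.le_of_antitoneOn (H : Profile h) (X : Exhaustion h ρ) (V : Evolution h v g)
    (Z : Barrier h ρ v g z a b r)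
    (hanti : AntitoneOn (fun t => posEnergy h fun x => v t x - z t x) (Ioo a b))
    (hcont : ∀ x ∈ funnel d h, Tendsto (fun t => z t x) (𝓝[>] a) (𝓝 (z a x)))
    (hstart : ∀ x ∈ funnel d h, v a x ≤ z a x) :
    ∀ t ∈ Ioo a b, ∀ x ∈ funnel d h, v t x ≤ z t x := by
  intro t ht
  obtain ⟨A, -, hA⟩ := Z.control V
  have hlim := H.tendsto_posEnergy (l := 𝓝[>] a) (w := fun t x => v t x - z t x)
    (w₀ := fun x => v a x - z a x) (X.compact r) (A := A)
    (by filter_upwards [Ioo_mem_nhdsGT (ht.1.trans ht.2)] with s hs using hA s hs)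
    (fun x hx => ((V.diff x hx a).continuousAt.tendsto.mono_left nhdsWithin_le_nhds).sub
      (hcont x hx))
  have h0 : posEnergy h (fun x => v a x - z a x) = 0 := by
    refine setIntegral_eq_zero_of_forall_eq_zero fun x hx => ?_
    rw [max_eq_right (by linarith [hstart x hx])]
    norm_num
  have hE : (posEnergy h fun x => v t x - z t x) ≤ 0 := by
    rw [← h0]
    refine ge_of_tendsto hlim ?_
    filter_upwards [Ioo_mem_nhdsGT ht.1] with s hs
    exact hanti ⟨hs.1, hs.2.trans ht.2⟩ ht hs.2.le
  intro x hx
  have := H.nonpos_of_posEnergy_le (X.compact r) (hA t ht).1 (hA t ht).2.1 (hA t ht).2.2 hE x hx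
  linarith

lemma isClosed_secondDiffSet (V : Evolution h v g) (n m : ℝ) :
    IsClosed (secondDiffSet h ρ v n m) := by
  have : secondDiffSet h ρ v n m = ⋂ (i : Fin (d + 1)) (x : Euc d) (δ : ℝ) (_ : 0 < δ)
      (_ : ∀ s ∈ Icc (-δ) δ, x + s • EuclideanSpace.single i 1 ∈ funnel d h ∧
      ρ (x + s • EuclideanSpace.single i 1) < m),
      {t | v t (x + δ • EuclideanSpace.single i 1) + v t (x + (-δ) • EuclideanSpace.single i 1)
      - 2 * v t (x + (0 : ℝ) • EuclideanSpace.single i 1) ≤ n * δ ^ 2} := by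
    ext t
    simp [secondDiffSet]
  rw [this]
  refine isClosed_iInter fun i => isClosed_iInter fun x => isClosed_iInter fun δ =>
    isClosed_iInter fun hδ => isClosed_iInter fun hs => isClosed_le ?_ continuous_const
  have c1 := (V.diff _ (hs δ ⟨by linarith, le_rfl⟩).1).continuous
  have c2 := (V.diff _ (hs (-δ) ⟨le_rfl, by linarith⟩).1).continuous
  have c3 := (V.diff _ (hs 0 ⟨by linarith, by linarith⟩).1).continuous
  exact (c1.add c2).sub (continuous_const.mul c3)

/-- The pure second derivative in the `i`-th direction within the closed funnel. -/
def secondPartial {d : ℕ} (h : ℝ → ℝ) (u : Euc d → ℝ) (i : Fin (d + 1)) (x : Euc d) : ℝ :=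
  fderivWithin ℝ (fun y => fderivWithin ℝ u (closure (funnel d h)) y (EuclideanSpace.single i 1))
    (closure (funnel d h)) x (EuclideanSpace.single i 1)

lemma Profile.hasDerivAt_line (H : Profile h) {u : Euc d → ℝ} {n : WithTop ℕ∞} (hn : n ≠ 0)
    (hu : ContDiffOn ℝ n u (closure (funnel d h))) (x e : Euc d) {s : ℝ}
    (hs : x + s • e ∈ funnel d h) :
    HasDerivAt (fun s : ℝ => u (x + s • e))
      (fderivWithin ℝ u (closure (funnel d h)) (x + s • e) e) s := by
  have h1 : HasFDerivAt u (fderivWithin ℝ u (closure (funnel d h)) (x + s • e)) (x + s • e) :=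
    ((hu.differentiableOn hn) _ (subset_closure hs)).hasFDerivWithinAt.hasFDerivAt
      (mem_of_superset (H.isOpen_funnel.mem_nhds hs) subset_closure)
  have h2 : HasDerivAt (fun s : ℝ => x + s • e) e s := by
    simpa using ((hasDerivAt_id s).smul_const e).const_add x
  exact h1.comp_hasDerivAt s h2

lemma Profile.continuousOn_secondPartial (H : Profile h) {u : Euc d → ℝ}
    (hu : ContDiffOn ℝ 2 u (closure (funnel d h))) (i : Fin (d + 1)) :
    ContinuousOn (secondPartial h u i) (closure (funnel d h)) :=
  ((hu.partialWithin H.uniqueDiffOn _).continuousOn_fderivWithin H.uniqueDiffOn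
    (by norm_num)).clm_apply continuousOn_const

lemma mem_secondDiffSet (H : Profile h) (V : Evolution h v g) {t n m : ℝ}
    (hn : ∀ i, ∀ x ∈ funnel d h, ρ x < m → secondPartial h (v t) i x ≤ n) :
    t ∈ secondDiffSet h ρ v n m := by
  intro i x δ hδ hs
  exact second_difference_le (k := fun s => v t (x + s • EuclideanSpace.single i 1)) hδ
    (fun s hs' => H.hasDerivAt_line two_ne_zero (V.reg t) x _ (hs s hs').1)
    (fun s hs' => H.hasDerivAt_line one_ne_zero ((V.reg t).partialWithin H.uniqueDiffOn _) x _
      (hs s hs').1) (fun s hs' => hn i _ (hs s hs').1 (hs s hs').2)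

lemma lapW_le_of_mem_secondDiffSet (H : Profile h) (X : Exhaustion h ρ) (V : Evolution h v g)
    {t n m : ℝ} (ht : t ∈ secondDiffSet h ρ v n m) {x : Euc d} (hx : x ∈ funnel d h)
    (hρ : ρ x < m) : lapW (closure (funnel d h)) (v t) x ≤ (d + 1) * n := by
  have key : ∀ i, secondPartial h (v t) i x ≤ n := by
    intro i
    set e : Euc d := EuclideanSpace.single i 1 with he
    have hline : Continuous fun s : ℝ => x + s • e := by fun_prop
    have hx0 : x + (0 : ℝ) • e = x := by simp
    have hnear : ∀ᶠ s : ℝ in 𝓝 0, x + s • e ∈ funnel d h ∧ ρ (x + s • e) < m := by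
      have : funnel d h ∩ {y | ρ y < m} ∈ 𝓝 (x + (0 : ℝ) • e) := by
        rw [hx0]
        exact (H.isOpen_funnel.inter (isOpen_lt X.smooth.continuous continuous_const)).mem_nhds
          ⟨hx, hρ⟩
      exact hline.continuousAt.eventually this
    have hc : ContinuousAt (fun s : ℝ => secondPartial h (v t) i (x + s • e)) 0 := by
      have h1 : ContinuousAt (secondPartial h (v t) i) (x + (0 : ℝ) • e) := by
        rw [hx0]
        exact (H.continuousOn_secondPartial (V.reg t) i).continuousAt
          (mem_of_superset (H.isOpen_funnel.mem_nhds hx) subset_closure)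
      exact ContinuousAt.comp (f := fun s : ℝ => x + s • e) h1 hline.continuousAt
    have := le_of_second_difference (k := fun s : ℝ => v t (x + s • e)) (n := n)
      (k₂ := fun s : ℝ => secondPartial h (v t) i (x + s • e))
      (hnear.mono fun s hs => H.hasDerivAt_line two_ne_zero (V.reg t) x e hs.1)
      (hnear.mono fun s hs => H.hasDerivAt_line one_ne_zero
        ((V.reg t).partialWithin H.uniqueDiffOn _) x e hs.1) hc ?_
    · simpa using this
    · obtain ⟨δ₀, hδ₀, hδ₁⟩ := Metric.eventually_nhds_iff.1 hnear
      filter_upwards [Ioo_mem_nhdsGT hδ₀] with δ hδ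
      refine ht i x δ hδ.1 fun s hs => hδ₁ ?_
      rw [Real.dist_0_eq_abs]
      exact (abs_le.2 hs).trans_lt hδ.2
  calc lapW (closure (funnel d h)) (v t) x = ∑ i, secondPartial h (v t) i x := rfl
    _ ≤ ∑ _i : Fin (d + 1), n := Finset.sum_le_sum fun i _ => key i
    _ = _ := by simp

/-- Every time belongs to some `secondDiffSet`. -/
lemma exists_mem_secondDiffSet (H : Profile h) (X : Exhaustion h ρ) (V : Evolution h v g)
    (t m : ℝ) : ∃ n : ℕ, t ∈ secondDiffSet h ρ v n m := by
  have : ∀ i, ∃ B : ℝ, ∀ x ∈ closure (funnel d h) ∩ {x | ρ x ≤ m}, secondPartial h (v t) i x ≤ B :=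
    fun i => by
      obtain ⟨B, hB⟩ := (X.compact m).bddAbove_image
        ((H.continuousOn_secondPartial (V.reg t) i).mono inter_subset_left)
      exact ⟨B, fun x hx => hB (mem_image_of_mem _ hx)⟩
  choose B hB using this
  obtain ⟨n, hn⟩ := exists_nat_ge (∑ i, |B i|)
  refine ⟨n, mem_secondDiffSet H V fun i x hx hρ => ?_⟩
  calc secondPartial h (v t) i x ≤ B i := hB i x ⟨subset_closure hx, le_of_lt hρ⟩
    _ ≤ |B i| := le_abs_self _
    _ ≤ ∑ i, |B i| := Finset.single_le_sum (f := fun i => |B i|) (fun i _ => abs_nonneg _)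
        (Finset.mem_univ i)
    _ ≤ n := hn

end

lemma contDiff_max_sub_cube (r : ℝ) : ContDiff ℝ 2 fun s : ℝ => max (s - r) 0 ^ 3 :=
  contDiff_max_zero_cube.comp (contDiff_id.sub contDiff_const)

lemma monotone_max_sub_cube (r : ℝ) : Monotone fun s : ℝ => max (s - r) 0 ^ 3 := by
  intro s t hst
  have : max (s - r) 0 ≤ max (t - r) 0 := max_le_max (by linarith) le_rfl
  have h0 : 0 ≤ max (s - r) 0 := le_max_right _ _
  simp only
  gcongr

section

variable {d : ℕ} {h : ℝ → ℝ} {ρ : Euc d → ℝ} {v g z : ℝ → Euc d → ℝ} {a b r : ℝ}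

/-- After a time at which the Laplacian is bounded above, `v` grows at most linearly as long as
the comparison principle is available. -/
lemma exists_linear_growth (H : Profile h) (X : Exhaustion h ρ) (V : Evolution h v g)
    (T N : ℝ) {r r' : ℝ} (hr : r < r') :
    ∃ C : ℝ, ∀ a, |a| ≤ T →
      (∀ x ∈ funnel d h, ρ x ≤ r' → lapW (closure (funnel d h)) (v a) x ≤ N) →
      (∀ x ∈ funnel d h, ρ x ≤ r → deriv (fun s => v s x) a < C) ∧
      ∀ τ, |τ| ≤ T → a < τ → (∀ s ∈ Ioo a τ, ComparableAt h ρ v g s r') →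
        ∀ x ∈ funnel d h, ρ x ≤ r → v τ x ≤ v a x + C * (τ - a) := by
  have hU := H.uniqueDiffOn (d := d)
  obtain ⟨M, hM⟩ := V.bdd T
  let pen : Euc d → ℝ := fun x => max (ρ x - r) 0 ^ 3
  have hpen : ContDiff ℝ 2 pen := (contDiff_max_sub_cube r).comp X.smooth
  obtain ⟨B, hB⟩ := (X.compact r').exists_bound_of_continuousOn
    ((continuousOn_lapW hU hpen.contDiffOn).mono inter_subset_left)
  let Λ : ℝ := 2 * |M| / (r' - r) ^ 3
  have hd : 0 < (r' - r) ^ 3 := pow_pos (sub_pos.2 hr) 3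
  have hΛ : 0 ≤ Λ := by positivity
  let C : ℝ := |N| + |M| + Λ * |B| + 1
  have hC : 0 ≤ C := by positivity
  refine ⟨C, fun a ha hN => ⟨fun x hx hρ => ?_, fun τ hτ haτ hcomp => ?_⟩⟩
  · rw [V.pde a x hx]
    have h1 := hN x hx (hρ.trans hr.le)
    have h2 := (hM a ha x hx).2
    have h3 : 0 ≤ Λ * |B| := by positivity
    simp only [C]
    linarith [le_abs_self N, le_abs_self M]
  let z : ℝ → Euc d → ℝ := fun t x => v a x + C * (t - a) + Λ * pen x
  have hzd : ∀ t x, HasDerivAt (fun s => z s x) C t := fun t x => by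
    have := ((((hasDerivAt_id t).sub_const a).const_mul C).const_add (v a x)).add_const
      (Λ * pen x)
    rwa [mul_one] at this
  have hvz : ∀ t, ContDiffOn ℝ 2 (fun x => v a x + C * (t - a)) (closure (funnel d h)) :=
    fun t => (V.reg a).add contDiffOn_const
  have hΛp : ContDiffOn ℝ 2 (fun x => Λ * pen x) (closure (funnel d h)) :=
    contDiffOn_const.mul hpen.contDiffOn
  have hpen0 : ∀ x, 0 ≤ Λ * pen x := fun x => by positivity
  have hτT : ∀ t ∈ Ioo a τ, |t| ≤ T := fun t ht =>
    (abs_le_max_abs_abs ht.1.le ht.2.le).trans (max_le ha hτ)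
  have hout : ∀ t ∈ Ioo a τ, ∀ x ∈ funnel d h, r' < ρ x → v t x ≤ z t x := by
    intro t ht x hx hρ
    have h1 := (abs_le.1 (hM a ha x hx).1).1
    have h2 : 0 ≤ C * (t - a) := mul_nonneg hC (by linarith [ht.1])
    have h3 := (abs_le.1 (hM t (hτT t ht) x hx).1).2
    have h4 : (r' - r) ^ 3 ≤ pen x := by
      simp only [pen]
      have : r' - r ≤ max (ρ x - r) 0 := le_max_of_le_left (by linarith)
      have h0 : 0 ≤ r' - r := by linarith
      gcongr
    have h5 : Λ * (r' - r) ^ 3 = 2 * |M| := div_mul_cancel₀ _ hd.ne'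
    have h6 : Λ * (r' - r) ^ 3 ≤ Λ * pen x := by gcongr
    simp only [z]
    linarith [le_abs_self M]
  have Z : Barrier h ρ v g z a τ r' := by
    refine ⟨fun t _ => (hvz t).add hΛp, fun t _ x _ => (hzd t x).differentiableAt,
      ⟨|M|, fun t ht x hx => ⟨?_, ?_⟩⟩, fun t _ x hx => ?_, fun t ht x hx hρ => ?_,
      fun t ht x hx hlt => ?_⟩
    · have h1 := (abs_le.1 (hM a ha x hx).1).1
      have h2 : 0 ≤ C * (t - a) := mul_nonneg hC (by linarith [ht.1])
      simp only [z]
      linarith [hpen0 x, le_abs_self M]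
    · rw [(hzd t x).deriv]
      linarith [abs_nonneg M]
    · have hxD := (H.mem_frontier.1 hx).1
      rw [show z t = fun x => (v a x + C * (t - a)) + Λ * pen x from rfl,
        H.normalDeriv_add (hvz t) hΛp hxD, H.normalDeriv_add (V.reg a) contDiffOn_const hxD,
        V.neu a x hx, normalDeriv_const, H.normalDeriv_const_mul hpen.contDiffOn _ hxD,
        H.normalDeriv_comp X.smooth.contDiffOn (contDiff_max_sub_cube r) hxD]
      have := mul_nonneg hΛ (mul_nonneg ((monotone_max_sub_cube r).deriv_nonneg (x := ρ x))
        (X.neu x hx))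
      linarith
    · exact hout t ht x hx hρ
    · have hρ : ρ x ≤ r' := not_lt.1 fun hc => not_le.2 hlt (hout t ht x hx hc)
      have hxD := subset_closure hx
      rw [(hzd t x).deriv, show z t = fun x => (v a x + C * (t - a)) + Λ * pen x from rfl,
        lapW_add hU (hvz t) hΛp hxD, lapW_add hU (V.reg a) contDiffOn_const hxD, lapW_const,
        lapW_const_mul hU hpen.contDiffOn _ hxD]
      have h1 := hN x hx hρ
      have h2 := (hM t (hτT t ht) x hx).2
      have h3 : Λ * lapW (closure (funnel d h)) pen x ≤ Λ * |B| := by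
        gcongr
        exact (le_abs_self _).trans ((hB x ⟨hxD, hρ⟩).trans (le_abs_self _))
      simp only [C]
      linarith [le_abs_self N, le_abs_self M]
  have hle := Z.le_of_antitoneOn H X V (Z.antitoneOn_energy H X V fun t ht => Or.inl (hcomp t ht))
    (fun x _ => (hzd a x).continuousAt.tendsto.mono_left nhdsWithin_le_nhds)
    (fun x _ => by simp only [z]; linarith [hpen0 x])
  intro x hx hρ
  have hz : z τ x = v a x + C * (τ - a) := by
    simp [z, pen, max_eq_right (sub_nonpos.2 hρ)]
  rw [← hz]
  refine le_of_tendsto_of_tendsto (b := 𝓝[<] τ)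
    ((V.diff x hx τ).continuousAt.tendsto.mono_left nhdsWithin_le_nhds)
    ((hzd τ x).continuousAt.tendsto.mono_left nhdsWithin_le_nhds) ?_
  filter_upwards [Ioo_mem_nhdsLT haτ] with s hs using hle s hs x hx

lemma comparableAt (H : Profile h) (X : Exhaustion h ρ) (V : Evolution h v g) (t r : ℝ) :
    ComparableAt h ρ v g t r := by
  let P : Set (ℝ × ℝ) := {p : ℝ × ℝ | ComparableAt h ρ v g p.1 p.2}ᶜ
  have hPc : IsClosed P := isOpen_comparableAt.isClosed_compl
  by_contra hbad
  have : Nonempty P := ⟨⟨(t, r), hbad⟩⟩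
  have : CompleteSpace P := hPc.completeSpace_coe
  let F : ℕ × ℕ → Set P := fun k =>
    Subtype.val ⁻¹' (secondDiffSet h ρ v k.1 k.2 ×ˢ Iic ((k.2 : ℝ) - 1))
  obtain ⟨k, ⟨⟨t₀, r₀⟩, hp₀⟩, hk⟩ := nonempty_interior_of_iUnion_of_closed (f := F)
    (fun k => ((isClosed_secondDiffSet V _ _).prod isClosed_Iic).preimage continuous_subtype_val)
    (by
      refine eq_univ_of_forall fun p => mem_iUnion.2 ?_
      obtain ⟨m, hm⟩ := exists_nat_ge (p.1.2 + 1)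
      obtain ⟨n, hn⟩ := exists_mem_secondDiffSet H X V p.1.1 m
      exact ⟨(n, m), hn, by simp only [mem_Iic]; linarith⟩)
  rw [mem_interior_iff_mem_nhds, Metric.mem_nhds_iff] at hk
  obtain ⟨η, hη, hball⟩ := hk
  have hP : ∀ s q, |s - t₀| < η → |q - r₀| < η → ¬ ComparableAt h ρ v g s q →
      s ∈ secondDiffSet h ρ v k.1 k.2 ∧ q ≤ (k.2 : ℝ) - 1 := by
    intro s q hs hq hsq
    have : (⟨(s, q), hsq⟩ : P) ∈ Metric.ball (⟨(t₀, r₀), hp₀⟩ : P) η := by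
      rw [Metric.mem_ball, Subtype.dist_eq, Prod.dist_eq, max_lt_iff, Real.dist_eq, Real.dist_eq]
      exact ⟨hs, hq⟩
    exact hball this
  obtain ⟨C, hC⟩ := exists_linear_growth H X V (|t₀| + η) ((d + 1) * (k.1 : ℝ))
    (show r₀ + η / 4 < r₀ + η / 2 by linarith)
  let S : Set ℝ := {s | ¬ ComparableAt h ρ v g s (r₀ + η / 2)}
  have hSc : IsClosed S := hPc.preimage (Continuous.prodMk continuous_id continuous_const)
  have hJ : ∀ s ∈ Ioo (t₀ - η) (t₀ + η), |s - t₀| < η ∧ |s| ≤ |t₀| + η := by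
    intro s hs
    have h1 : |s - t₀| < η := abs_lt.2 ⟨by linarith [hs.1], by linarith [hs.2]⟩
    exact ⟨h1, by linarith [abs_sub_abs_le_abs_sub s t₀]⟩
  have hlap : ∀ s ∈ Ioo (t₀ - η) (t₀ + η), s ∈ S → ∀ x ∈ funnel d h, ρ x ≤ r₀ + η / 2 →
      lapW (closure (funnel d h)) (v s) x ≤ (d + 1) * (k.1 : ℝ) := by
    intro s hs hsS x hx hρ
    obtain ⟨h1, h2⟩ := hP s (r₀ + η / 2) (hJ s hs).1
      (by rw [add_sub_cancel_left, abs_of_pos (by positivity)]; linarith) hsS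
    exact lapW_le_of_mem_secondDiffSet H X V h1 hx (by linarith)
  have hgrow : ∀ s ∈ Ioo (t₀ - η) (t₀ + η), s ∈ S → ∀ τ, s ≤ τ → τ < t₀ + η →
      ∀ x ∈ funnel d h, ρ x ≤ r₀ + η / 4 → v τ x ≤ v s x + C * (τ - s) := by
    intro s hs hsS τ hsτ hτ x hx hρ
    have hcont : Continuous fun q => v q x := (V.diff x hx).continuous
    suffices hh : v τ x - C * τ ≤ v s x - C * s by linarith
    refine le_of_forall_gap (p := fun q => v q x - C * q) hsτ
      (hcont.sub (continuous_const.mul continuous_id)) hSc hsS (fun q hqS hq => ?_)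
      (fun a' haS hsa b' hb hdisj => ?_)
    · have hqJ : q ∈ Ioo (t₀ - η) (t₀ + η) := ⟨hs.1.trans_le hq.1, hq.2.trans hτ⟩
      have hd := (hC q (hJ q hqJ).2 (hlap q hqJ hqS)).1 x hx hρ
      have hslope := (V.diff x hx q).hasDerivAt.tendsto_slope.mono_left
        (nhdsWithin_mono q fun s (hs : q < s) => hs.ne')
      filter_upwards [hslope.eventually (gt_mem_nhds hd), self_mem_nhdsWithin] with q' h1 h2
      rw [slope_def_field, div_lt_iff₀ (sub_pos.2 h2)] at h1
      linarith
    · have haJ : a' ∈ Ioo (t₀ - η) (t₀ + η) :=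
        ⟨hs.1.trans_le hsa, hb.1.trans_le (hb.2.trans hτ.le)⟩
      have hbJ : b' ∈ Ioo (t₀ - η) (t₀ + η) := ⟨haJ.1.trans hb.1, hb.2.trans_lt hτ⟩
      have := (hC a' (hJ a' haJ).2 (hlap a' haJ haS)).2 b' (hJ b' hbJ).2 hb.1
        (fun q hq => not_not.1 fun hn => Set.disjoint_left.1 hdisj hq hn) x hx hρ
      linarith
  refine hp₀ ⟨η / 4, by positivity, ?_⟩
  intro a b z hab Z
  refine Z.antitoneOn_energy H X V fun s hs => ?_
  have hsJ : s ∈ Ioo (t₀ - η) (t₀ + η) := by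
    have := hab hs
    simp only at this
    exact ⟨by linarith [this.1], by linarith [this.2]⟩
  by_cases hsS : s ∈ S
  · refine Or.inr ⟨C, ?_⟩
    filter_upwards [Ioo_mem_nhdsGT hsJ.2] with τ hτ x hx hρ
    exact hgrow s hsJ hsS τ hτ.1.le hτ.2 x hx hρ
  · exact Or.inl ((not_not.1 hsS).mono (by simp only; linarith))

/-- The comparison principle. -/
theorem Barrier.le (H : Profile h) (X : Exhaustion h ρ) (V : Evolution h v g)
    (Z : Barrier h ρ v g z a b r)
    (hcont : ∀ x ∈ funnel d h, Tendsto (fun t => z t x) (𝓝[>] a) (𝓝 (z a x)))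
    (hstart : ∀ x ∈ funnel d h, v a x ≤ z a x) :
    ∀ t ∈ Ioo a b, ∀ x ∈ funnel d h, v t x ≤ z t x :=
  Z.le_of_antitoneOn H X V
    (Z.antitoneOn_energy H X V fun t _ => Or.inl (comparableAt H X V t r)) hcont hstart

end

/-- A smooth convex function of one variable comparable with `|s|`. -/
def spread (s : ℝ) : ℝ := Real.sqrt (1 + s ^ 2) - 1

lemma one_le_sqrt_one_add_sq (s : ℝ) : 1 ≤ Real.sqrt (1 + s ^ 2) :=
  Real.one_le_sqrt.2 (by nlinarith [sq_nonneg s])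

lemma spread_nonneg (s : ℝ) : 0 ≤ spread s := sub_nonneg.2 (one_le_sqrt_one_add_sq s)

lemma contDiff_spread {n : WithTop ℕ∞} : ContDiff ℝ n spread :=
  ((contDiff_const.add (contDiff_id.pow 2)).sqrt fun s => by positivity).sub contDiff_const

lemma hasDerivAt_sqrt_one_add_sq (s : ℝ) :
    HasDerivAt (fun s : ℝ => Real.sqrt (1 + s ^ 2)) (s / Real.sqrt (1 + s ^ 2)) s := by
  have h1 : HasDerivAt (fun s : ℝ => 1 + s ^ 2) (2 * s) s := by
    simpa using (hasDerivAt_pow 2 s).const_add 1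
  refine (h1.sqrt (by positivity)).congr_deriv ?_
  have := one_le_sqrt_one_add_sq s
  field_simp

lemma deriv_spread : deriv spread = fun s => s / Real.sqrt (1 + s ^ 2) :=
  funext fun s => ((hasDerivAt_sqrt_one_add_sq s).sub_const 1).deriv

lemma deriv_deriv_spread_nonneg (s : ℝ) : 0 ≤ deriv (deriv spread) s := by
  have h1 := one_le_sqrt_one_add_sq s
  have h2 : Real.sqrt (1 + s ^ 2) ^ 2 = 1 + s ^ 2 := Real.sq_sqrt (by positivity)
  rw [deriv_spread, ((hasDerivAt_id' s).fun_div (hasDerivAt_sqrt_one_add_sq s)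
    (by positivity)).deriv]
  refine div_nonneg ?_ (by positivity)
  have : s * (s / Real.sqrt (1 + s ^ 2)) ≤ Real.sqrt (1 + s ^ 2) := by
    rw [mul_div_assoc', div_le_iff₀ (by positivity)]
    nlinarith
  linarith

lemma deriv_deriv_spread_le (s : ℝ) : deriv (deriv spread) s ≤ 1 := by
  have h1 := one_le_sqrt_one_add_sq s
  rw [deriv_spread, ((hasDerivAt_id' s).fun_div (hasDerivAt_sqrt_one_add_sq s)
    (by positivity)).deriv]
  rw [div_le_one (by positivity)]
  have : 0 ≤ s * (s / Real.sqrt (1 + s ^ 2)) := by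
    rw [mul_div_assoc']
    exact div_nonneg (mul_self_nonneg s) (by positivity)
  nlinarith

lemma deriv_spread_le_one (s : ℝ) : deriv spread s ≤ 1 := by
  have h1 := one_le_sqrt_one_add_sq s
  rw [deriv_spread]
  simp only
  rw [div_le_one (by positivity)]
  exact Real.le_sqrt_of_sq_le (by linarith)

lemma spread_le_sq_deriv_mul (s : ℝ) : spread s ≤ deriv spread s ^ 2 * (1 + spread s) := by
  have h1 := one_le_sqrt_one_add_sq s
  have h2 : Real.sqrt (1 + s ^ 2) ^ 2 = 1 + s ^ 2 := Real.sq_sqrt (by positivity)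
  rw [deriv_spread, spread]
  simp only
  set w := Real.sqrt (1 + s ^ 2)
  have h3 : s ^ 2 = w ^ 2 - 1 := by linarith
  rw [div_pow, h3, add_sub_cancel, div_mul_eq_mul_div, le_div_iff₀ (by positivity)]
  nlinarith [mul_nonneg (sub_nonneg.2 h1) (sub_nonneg.2 h1)]

lemma abs_le_one_add_spread (s : ℝ) : |s| ≤ 1 + spread s := by
  rw [spread, add_sub_cancel]
  exact Real.abs_le_sqrt (by linarith)

lemma lt_one_of_spread_lt {s : ℝ} (hs : spread s < 1 / 4) : s < 1 := by
  rw [spread] at hs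
  have h1 := one_le_sqrt_one_add_sq s
  have h2 : Real.sqrt (1 + s ^ 2) ^ 2 = 1 + s ^ 2 := Real.sq_sqrt (by positivity)
  nlinarith

section

variable {d : ℕ} {s : Set (Euc d)} {h : ℝ → ℝ}

lemma fderiv_coord_comp {F : ℝ → ℝ} (hF : ContDiff ℝ 2 F) (x v : Euc d) :
    fderiv ℝ (fun y : Euc d => F (y 0)) x v = deriv F (x 0) * v 0 := by
  have := ((hF.differentiable (by norm_num)) (x 0)).hasDerivAt.comp_hasFDerivAt x
    (hasFDerivAt_coord (d := d) 0 x)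
  have h2 := this.fderiv
  rw [show (fun y : Euc d => F (y 0)) = F ∘ fun y : Euc d => y 0 from rfl, h2]
  simp

lemma lapW_coord_comp {F : ℝ → ℝ} (hs : UniqueDiffOn ℝ s) (hF : ContDiff ℝ 2 F) {x : Euc d}
    (hx : x ∈ s) : lapW s (fun y => F (y 0)) x = deriv (deriv F) (x 0) := by
  have h0 : lapW s (fun y : Euc d => y 0) x = 0 := by
    rw [lapW_eq_of_contDiff hs (contDiff_coord 0) hx]
    simp [fderiv_coord]
  rw [lapW_comp hs (contDiff_coord 0).contDiffOn hF hx, h0, Fin.sum_univ_succ]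
  have h1 : ∀ i, fderivWithin ℝ (fun y : Euc d => y 0) s x (EuclideanSpace.single i 1)
      = (EuclideanSpace.single i (1:ℝ) : Euc d) 0 := fun i => by
    rw [((contDiff_coord (n := 1) 0).differentiable (by norm_num) x).fderivWithin (hs x hx),
      fderiv_coord]
  simp [h1]

lemma lapW_sqPrime (hs : UniqueDiffOn ℝ s) {x : Euc d} (hx : x ∈ s) :
    lapW s sqPrime x = 2 * d := by
  rw [lapW_eq_of_contDiff hs contDiff_sqPrime hx, Fin.sum_univ_succ]
  simp only [fderiv_sqPrime]
  have h2 : ∀ j : Fin d, fderiv ℝ (fun y : Euc d => 2 * y j.succ) x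
      (EuclideanSpace.single j.succ 1) = 2 := fun j => by
    rw [((hasFDerivAt_coord j.succ x).const_mul 2).fderiv]
    simp
  simp [h2, mul_comm]

/-- The exhaustion function centred at height `y`. -/
def heightFun (B y : ℝ) (x : Euc d) : ℝ := sqPrime x + B * spread (x 0 - y)

lemma contDiff_spread_sub (B y : ℝ) : ContDiff ℝ 2 fun s : ℝ => B * spread (s - y) :=
  contDiff_const.mul (contDiff_spread.comp (contDiff_id.sub contDiff_const))

lemma deriv_spread_sub (B y : ℝ) :
    deriv (fun s : ℝ => B * spread (s - y)) = fun s => B * deriv spread (s - y) := by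
  ext s
  have h1 : DifferentiableAt ℝ (fun s => spread (s - y)) s :=
    (contDiff_spread (n := 1)).differentiable (by norm_num) _ |>.comp s
      (differentiableAt_id.sub_const y)
  rw [deriv_const_mul _ h1, deriv_comp_sub_const]

lemma deriv_deriv_spread_sub (B y s : ℝ) :
    deriv (deriv fun s : ℝ => B * spread (s - y)) s = B * deriv (deriv spread) (s - y) := by
  have hF' : ContDiff ℝ 1 (deriv spread) := by
    have : ContDiff ℝ (1 + 1) spread := contDiff_spread
    exact (contDiff_succ_iff_deriv.1 this).2.2
  have h1 : DifferentiableAt ℝ (fun s => deriv spread (s - y)) s :=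
    hF'.differentiable (by norm_num) _ |>.comp s (differentiableAt_id.sub_const y)
  rw [deriv_spread_sub, deriv_const_mul _ h1, deriv_comp_sub_const (f := deriv spread)]

lemma contDiff_spread_coord (B y : ℝ) :
    ContDiff ℝ 2 fun x : Euc d => B * spread (x 0 - y) :=
  (contDiff_spread_sub B y).comp (contDiff_coord 0)

lemma contDiff_heightFun (B y : ℝ) : ContDiff ℝ 2 (heightFun (d := d) B y) :=
  contDiff_sqPrime.add (contDiff_spread_coord B y)

lemma heightFun_nonneg {B : ℝ} (hB : 0 ≤ B) (y : ℝ) (x : Euc d) : 0 ≤ heightFun B y x :=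
  add_nonneg (sqPrime_nonneg x) (mul_nonneg hB (spread_nonneg _))

lemma lapW_heightFun (hs : UniqueDiffOn ℝ s) (B y : ℝ) {x : Euc d} (hx : x ∈ s) :
    lapW s (heightFun B y) x = 2 * d + B * deriv (deriv spread) (x 0 - y) := by
  have h1 : heightFun (d := d) B y = fun x => sqPrime x + B * spread (x 0 - y) := rfl
  rw [h1, lapW_add hs contDiff_sqPrime.contDiffOn (contDiff_spread_coord B y).contDiffOn hx,
    lapW_sqPrime hs hx, lapW_coord_comp (F := fun s => B * spread (s - y)) hs
      (contDiff_spread_sub B y) hx, deriv_deriv_spread_sub]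

lemma lapW_heightFun_le (hs : UniqueDiffOn ℝ s) {B : ℝ} (hB : 0 ≤ B) (y : ℝ) {x : Euc d}
    (hx : x ∈ s) : lapW s (heightFun B y) x ≤ 2 * d + B := by
  rw [lapW_heightFun hs B y hx]
  nlinarith [deriv_deriv_spread_le (x 0 - y)]

lemma fderiv_heightFun (B y : ℝ) (x v : Euc d) :
    fderiv ℝ (heightFun B y) x v =
      2 * ∑ i : Fin d, x i.succ * v i.succ + B * deriv spread (x 0 - y) * v 0 := by
  have h1 : heightFun (d := d) B y = fun x => sqPrime x + B * spread (x 0 - y) := rfl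
  rw [h1, fderiv_fun_add (contDiff_sqPrime (n := 1).differentiable (by norm_num) x)
    ((contDiff_spread_coord B y).differentiable (by norm_num) x), add_apply,
    fderiv_sqPrime,
    fderiv_coord_comp (F := fun s => B * spread (s - y)) (contDiff_spread_sub B y),
    deriv_spread_sub]

lemma sum_sq_fderivWithin_heightFun (hs : UniqueDiffOn ℝ s) (B y : ℝ) {x : Euc d} (hx : x ∈ s) :
    ∑ i, fderivWithin ℝ (heightFun B y) s x (EuclideanSpace.single i 1) ^ 2
      = 4 * sqPrime x + (B * deriv spread (x 0 - y)) ^ 2 := by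
  rw [((contDiff_heightFun B y).differentiable (by norm_num) x).fderivWithin (hs x hx),
    Fin.sum_univ_succ]
  simp only [fderiv_heightFun]
  simp [sqPrime, Finset.mul_sum, mul_pow, add_comm]
  norm_num

/-- The gradient of the exhaustion function is bounded below away from its minimum. -/
lemma exists_le_sum_sq_fderivWithin_heightFun (hs : UniqueDiffOn ℝ s) {B : ℝ} (hB : 0 < B)
    (y : ℝ) {m : ℝ} (hm : 0 < m) : ∃ κ > 0, ∀ x ∈ s, m ≤ heightFun B y x →
      κ ≤ ∑ i, fderivWithin ℝ (heightFun B y) s x (EuclideanSpace.single i 1) ^ 2 := by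
  refine ⟨min (2 * m) (B ^ 2 * (m / (2 * B) / (1 + m / (2 * B)))), by positivity, ?_⟩
  intro x hx hmx
  rw [sum_sq_fderivWithin_heightFun hs B y hx]
  by_cases h1 : m / 2 ≤ sqPrime x
  · refine (min_le_left _ _).trans ?_
    nlinarith [sq_nonneg (B * deriv spread (x 0 - y))]
  · refine (min_le_right _ _).trans ?_
    have h2 : m / (2 * B) ≤ spread (x 0 - y) := by
      rw [heightFun] at hmx
      rw [div_le_iff₀ (by positivity)]
      nlinarith
    have h3 : m / (2 * B) / (1 + m / (2 * B)) ≤ deriv spread (x 0 - y) ^ 2 := by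
      have h4 := spread_le_sq_deriv_mul (x 0 - y)
      have h5 : 0 < m / (2 * B) := by positivity
      set t := m / (2 * B)
      refine le_trans ?_ (div_le_iff₀ (by linarith) |>.2 h4)
      rw [div_le_div_iff₀ (by linarith) (by linarith)]
      nlinarith
    rw [mul_pow]
    nlinarith [sqPrime_nonneg x, mul_le_mul_of_nonneg_left h3 (sq_nonneg B)]

lemma sq_coord_le_of_heightFun_le {B y r : ℝ} (hB : 0 < B) {x : Euc d}
    (hx : heightFun B y x ≤ r) (i : Fin (d + 1)) :
    |x i| ≤ max (Real.sqrt r) (|y| + 1 + r / B) := by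
  have h0 := sqPrime_nonneg x
  have h1 := mul_nonneg hB.le (spread_nonneg (x 0 - y))
  rw [heightFun] at hx
  refine Fin.cases ?_ (fun j => ?_) i
  · refine le_trans ?_ (le_max_right _ _)
    have h2 := abs_le_one_add_spread (x 0 - y)
    have h3 : spread (x 0 - y) ≤ r / B := by
      rw [le_div_iff₀ hB]; linarith
    have := abs_add_le (x 0 - y) y
    rw [sub_add_cancel] at this
    linarith
  · refine le_trans (Real.abs_le_sqrt ?_) (le_max_left _ _)
    have : x j.succ ^ 2 ≤ sqPrime x :=
      Finset.single_le_sum (f := fun i : Fin d => x i.succ ^ 2) (fun _ _ => sq_nonneg _)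
        (Finset.mem_univ j)
    linarith

lemma Profile.exhaustion_heightFun (H : Profile h) {R A : ℝ} (hR : 0 < R) (hA : 0 ≤ A)
    (hRh : ∀ s, R ≤ h s) (hd : ∀ s, deriv h s ≤ A) (y : ℝ) :
    Exhaustion h (heightFun (d := d) (R / (1 + A)) y) := by
  have hB : 0 < R / (1 + A) := by positivity
  refine ⟨contDiff_heightFun _ _, fun r => ?_, fun x hx => ?_⟩
  · refine Metric.isCompact_of_isClosed_isBounded (isClosed_closure.inter
      (isClosed_le (contDiff_heightFun _ _).continuous continuous_const)) ?_
    set M := max (Real.sqrt r) (|y| + 1 + r / (R / (1 + A)))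
    refine isBounded_iff_forall_norm_le.2 ⟨Real.sqrt (∑ i : Fin (d + 1), M ^ 2), fun x hx => ?_⟩
    rw [EuclideanSpace.norm_eq]
    refine Real.sqrt_le_sqrt (Finset.sum_le_sum fun i _ => ?_)
    have := sq_coord_le_of_heightFun_le hB hx.2 i
    rw [Real.norm_eq_abs]
    gcongr
  · obtain ⟨h1, h2⟩ := H.mem_frontier.1 hx
    rw [H.normalDeriv_eq_fderiv (contDiff_heightFun _ _) h1, fderiv_heightFun]
    have h3 : ∑ i : Fin d, x i.succ * outNormal h x i.succ = h (x 0) ^ 2 := by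
      rw [funnelFun, sqPrime] at h2
      rw [← sub_eq_zero, ← neg_eq_zero, neg_sub, ← h2]
      simp [outNormal, pow_two]
    have h4 : outNormal h x 0 = -(h (x 0) * deriv h (x 0)) := rfl
    rw [h3, h4]
    have h5 := hRh (x 0)
    have h6 := hd (x 0)
    have h7 := H.mono.deriv_nonneg (x := x 0)
    have h8 := deriv_spread_le_one (x 0 - y)
    have h9 : R / (1 + A) * deriv h (x 0) ≤ R := by
      rw [div_mul_eq_mul_div, div_le_iff₀ (by positivity)]
      nlinarith
    have h10 : R / (1 + A) * deriv h (x 0) * deriv spread (x 0 - y) ≤ R := by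
      have : 0 ≤ R / (1 + A) * deriv h (x 0) := by positivity
      nlinarith
    nlinarith [H.pos (x 0)]

end

lemma IsFunnel.le_profile {d : ℕ} {R α L : ℝ} {h : ℝ → ℝ} (hΩ : IsFunnel d R α L h) :
    ∀ s, R ≤ h s := by
  intro s
  have hm := monotone_of_deriv_nonneg (hΩ.smooth.differentiable (by norm_num)) hΩ.deriv_nonneg
  rcases le_total s 0 with hs | hs
  · exact (hΩ.left s hs).ge
  · rw [← hΩ.left 0 le_rfl]; exact hm hs

lemma IsFunnel.profile {d : ℕ} {R α L : ℝ} {h : ℝ → ℝ} (hΩ : IsFunnel d R α L h) :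
    Profile h :=
  ⟨hΩ.smooth, fun s => hΩ.Rpos.trans_le (hΩ.le_profile s),
    monotone_of_deriv_nonneg (hΩ.smooth.differentiable (by norm_num)) hΩ.deriv_nonneg⟩

section

variable {f φ : ℝ → ℝ} {θ c : ℝ}

lemma Bistable.deriv_of_neg (hf : Bistable f θ) {s : ℝ} (hs : s < 0) : deriv f s = deriv f 0 := by
  have h1 : f =ᶠ[𝓝 s] fun y => deriv f 0 * y :=
    (eventually_lt_nhds hs).mono fun y hy => hf.ext_neg y hy
  rw [h1.deriv_eq, deriv_const_mul _ differentiableAt_fun_id]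
  simp

lemma Bistable.deriv_of_one_lt (hf : Bistable f θ) {s : ℝ} (hs : 1 < s) :
    deriv f s = deriv f 1 := by
  have h1 : f =ᶠ[𝓝 s] fun y => deriv f 1 * (y - 1) :=
    (eventually_gt_nhds hs).mono fun y hy => hf.ext_pos y hy
  rw [h1.deriv_eq, deriv_const_mul _ (differentiableAt_fun_id.sub_const 1)]
  simp

lemma Bistable.differentiable (hf : Bistable f θ) : Differentiable ℝ f :=
  hf.smooth.differentiable (by norm_num)

lemma Bistable.continuous_deriv (hf : Bistable f θ) : Continuous (deriv f) :=
  hf.smooth.continuous_deriv (by norm_num)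

lemma Bistable.exists_lipschitz (hf : Bistable f θ) :
    ∃ K > 0, ∀ s t : ℝ, |f s - f t| ≤ K * |s - t| := by
  obtain ⟨M, hM⟩ := isCompact_Icc.exists_bound_of_continuousOn (s := Icc (0 : ℝ) 1)
    hf.continuous_deriv.continuousOn
  have hM0 : 0 ≤ M := (norm_nonneg _).trans (hM 0 (by simp))
  refine ⟨M + 1, by linarith, fun s t => ?_⟩
  have hb : ∀ x ∈ (univ : Set ℝ), ‖deriv f x‖ ≤ M + 1 := by
    intro x _
    rcases lt_or_ge x 0 with h0 | h0
    · rw [hf.deriv_of_neg h0]; linarith [hM 0 (by simp)]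
    · rcases lt_or_ge 1 x with h1 | h1
      · rw [hf.deriv_of_one_lt h1]; linarith [hM 1 (by simp)]
      · linarith [hM x ⟨h0, h1⟩]
  have := convex_univ.norm_image_sub_le_of_norm_deriv_le (fun x _ => hf.differentiable x) hb
    (mem_univ t) (mem_univ s)
  simpa [Real.norm_eq_abs] using this

lemma Bistable.exists_deriv_le (hf : Bistable f θ) :
    ∃ δ > 0, ∃ μ > 0, ∀ s : ℝ, s ≤ 2 * δ ∨ 1 - δ ≤ s → deriv f s ≤ -μ := by
  set μ := min (-deriv f 0) (-deriv f 1) / 2 with hμ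
  have h0 := hf.df0
  have h1 := hf.df1
  have hm : 0 < min (-deriv f 0) (-deriv f 1) := lt_min (by linarith) (by linarith)
  have hμ0 : 0 < μ := by positivity
  have e0 : deriv f 0 < -μ := by
    have := min_le_left (-deriv f 0) (-deriv f 1); linarith
  have e1 : deriv f 1 < -μ := by
    have := min_le_right (-deriv f 0) (-deriv f 1); linarith
  obtain ⟨a, ha, ha'⟩ := Metric.eventually_nhds_iff.1
    (hf.continuous_deriv.continuousAt.eventually (eventually_lt_nhds e0))
  obtain ⟨b, hb, hb'⟩ := Metric.eventually_nhds_iff.1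
    (hf.continuous_deriv.continuousAt.eventually (eventually_lt_nhds e1))
  refine ⟨min a b / 3, by positivity, μ, hμ0, fun s hs => ?_⟩
  have l1 := min_le_left a b
  have l2 := min_le_right a b
  rcases hs with hs | hs
  · rcases lt_or_ge s 0 with h | h
    · rw [hf.deriv_of_neg h]; exact e0.le
    · refine (ha' ?_).le
      rw [Real.dist_eq, sub_zero, abs_of_nonneg h]; linarith
  · rcases lt_or_ge 1 s with h | h
    · rw [hf.deriv_of_one_lt h]; exact e1.le
    · refine (hb' ?_).le
      rw [Real.dist_eq, abs_sub_comm, abs_of_nonneg (by linarith)]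
      have : 0 < min a b := lt_min ha hb
      linarith

lemma Bistable.eq_theta_of_eq_zero (hf : Bistable f θ) {s : ℝ} (hs : s ∈ Ioo (0 : ℝ) 1)
    (h0 : f s = 0) : s = θ := by
  rcases lt_trichotomy s θ with h | h | h
  · exact absurd h0 (hf.neg s ⟨hs.1, h⟩).ne
  · exact h
  · exact absurd h0 (hf.pos s ⟨h, hs.2⟩).ne'

lemma PlanarFront.differentiable (hφ : PlanarFront f θ c φ) : Differentiable ℝ φ :=
  hφ.smooth.differentiable (by norm_num)

lemma PlanarFront.contDiff_deriv (hφ : PlanarFront f θ c φ) : ContDiff ℝ 1 (deriv φ) := by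
  have : ContDiff ℝ (1 + 1) φ := by simpa [one_add_one_eq_two] using hφ.smooth
  exact (contDiff_succ_iff_deriv.1 this).2.2

lemma PlanarFront.deriv_nonpos (hφ : PlanarFront f θ c φ) (z : ℝ) : deriv φ z ≤ 0 :=
  hφ.anti.antitone.deriv_nonpos

/-- The front has no critical point. -/
lemma PlanarFront.deriv_neg (hf : Bistable f θ) (hφ : PlanarFront f θ c φ) (z : ℝ) :
    deriv φ z < 0 := by
  refine (hφ.deriv_nonpos z).lt_of_ne fun h0 => ?_
  have hmax : IsLocalMax (deriv φ) z :=
    Eventually.of_forall fun y => by rw [h0]; exact hφ.deriv_nonpos y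
  have h2 := hφ.ode z
  rw [hmax.deriv_eq_zero, h0] at h2
  have hθ : φ z = θ := hf.eq_theta_of_eq_zero (hφ.mem z) (by linarith)
  obtain ⟨K, hK, hL⟩ := hf.exists_lipschitz
  let F : ℝ × ℝ → ℝ × ℝ := fun p => (p.2, -c * p.2 - f p.1)
  have hfl : LipschitzWith (Real.toNNReal K) f := LipschitzWith.of_dist_le_mul fun s t => by
    rw [Real.dist_eq, Real.dist_eq, Real.coe_toNNReal K hK.le]; exact hL s t
  have hF : LipschitzWith (max 1 (‖-c‖₊ * 1 + Real.toNNReal K * 1)) F :=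
    LipschitzWith.prodMk LipschitzWith.prod_snd
      (((lipschitzWith_smul (-c)).comp LipschitzWith.prod_snd).sub
        (hfl.comp LipschitzWith.prod_fst))
  have hA : ∀ t, HasDerivAt (fun t => (φ t, deriv φ t)) (F (φ t, deriv φ t)) t := fun t => by
    refine ((hφ.differentiable t).hasDerivAt.prodMk
      ((hφ.contDiff_deriv.differentiable (by norm_num)) t).hasDerivAt).congr_deriv ?_
    have := hφ.ode t
    simp only [F, Prod.mk.injEq, true_and]
    linarith
  have hB : ∀ t, HasDerivAt (fun _ : ℝ => (θ, (0 : ℝ))) (F (θ, 0)) t := fun t => by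
    have : F (θ, 0) = 0 := by
      have : f θ = 0 := by rw [← hθ]; linarith
      simp [F, this]
    rw [this]; exact hasDerivAt_const t _
  have := ODE_solution_unique_univ (v := fun _ => F) (s := fun _ => univ)
    (fun _ => hF.lipschitzOnWith) (fun t => ⟨hA t, mem_univ _⟩) (fun t => ⟨hB t, mem_univ _⟩)
    (t₀ := z) (by simp [hθ, h0])
  have h3 : φ (z + 1) = θ := congrArg Prod.fst (congrFun this (z + 1))
  have h4 := hφ.anti (show z < z + 1 by linarith)
  rw [h3, hθ] at h4
  exact lt_irrefl _ h4

lemma PlanarFront.exists_slope (hf : Bistable f θ) (hφ : PlanarFront f θ c φ) {δ : ℝ}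
    (hδ : 0 < δ) : ∃ κ > 0, ∀ z, δ < φ z → φ z < 1 - δ → deriv φ z ≤ -κ := by
  obtain ⟨a, ha⟩ := eventually_atBot.1 (hφ.lim_bot.eventually (eventually_gt_nhds
    (show 1 - δ < 1 by linarith)))
  obtain ⟨b, hb⟩ := eventually_atTop.1 (hφ.lim_top.eventually (eventually_lt_nhds hδ))
  have hc : ContinuousOn (deriv φ) (Icc a b) := hφ.contDiff_deriv.continuous.continuousOn
  have hmem : ∀ z, δ < φ z → φ z < 1 - δ → z ∈ Icc a b := fun z h1 h2 =>
    ⟨le_of_not_gt fun h => absurd (ha z h.le) (by linarith),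
      le_of_not_gt fun h => absurd (hb z h.le) (by linarith)⟩
  rcases (Icc a b).eq_empty_or_nonempty with he | hne
  · exact ⟨1, one_pos, fun z h1 h2 => absurd (hmem z h1 h2) (by simp [he])⟩
  · obtain ⟨z0, -, h0⟩ := isCompact_Icc.exists_isMaxOn hne hc
    refine ⟨-deriv φ z0, by linarith [hφ.deriv_neg hf z0], fun z h1 h2 => ?_⟩
    rw [neg_neg]
    exact h0 (hmem z h1 h2)

/-- The key inequality behind the perturbed travelling front being a supersolution. -/
lemma PlanarFront.exists_perturbation (hf : Bistable f θ) (hφ : PlanarFront f θ c φ) :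
    ∃ δ > 0, ∃ μ > 0, ∃ ω > 0, ∀ z q : ℝ, 0 ≤ q → q ≤ δ →
      f (φ z + q) - f (φ z) ≤ -(ω * q * deriv φ z) - μ * q := by
  obtain ⟨K, hK, hL⟩ := hf.exists_lipschitz
  obtain ⟨δ, hδ, μ, hμ, hd⟩ := hf.exists_deriv_le
  obtain ⟨κ, hκ, hs⟩ := hφ.exists_slope hf hδ
  refine ⟨δ, hδ, μ, hμ, (K + μ) / κ, by positivity, fun z q hq hqδ => ?_⟩
  have hω : 0 < (K + μ) / κ := by positivity
  by_cases hz : φ z ≤ δ ∨ 1 - δ ≤ φ z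
  · have h1 : f (φ z + q) - f (φ z) ≤ -μ * (φ z + q - φ z) := by
      refine (convex_Icc (φ z) (φ z + q)).image_sub_le_mul_sub_of_deriv_le
        hf.differentiable.continuous.continuousOn hf.differentiable.differentiableOn
        (fun s hs => hd s ?_) _ (by simp [hq]) _ (by simp [hq]) (by linarith)
      have hs := interior_subset hs
      rcases hz with hz | hz
      · left; linarith [hs.2]
      · right; linarith [hs.1]
    have h2 : 0 ≤ (K + μ) / κ * q := by positivity
    nlinarith [hφ.deriv_nonpos z]
  · push Not at hz
    have h1 := le_of_abs_le (hL (φ z + q) (φ z))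
    rw [add_sub_cancel_left, abs_of_nonneg hq] at h1
    have h2 := hs z hz.1 hz.2
    have h3 : (K + μ) / κ * q * deriv φ z ≤ (K + μ) / κ * q * (-κ) :=
      mul_le_mul_of_nonneg_left h2 (by positivity)
    have h4 : (K + μ) / κ * q * (-κ) = -((K + μ) * q) := by field_simp
    linarith

end

/-- Exponentially rescaled solutions. -/
lemma IsEntireSolution.evolution {d : ℕ} {h f φ : ℝ → ℝ} {c θ : ℝ} {u : ℝ → Euc d → ℝ}
    (hf : Bistable f θ) (H : Profile h) (hu : IsEntireSolution d h f c φ u) (a k : ℝ) :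
    Evolution h (fun t x => a * Real.exp (k * t) * u t x)
      (fun t x => a * Real.exp (k * t) * (f (u t x) + k * u t x)) := by
  have hU := H.uniqueDiffOn (d := d)
  obtain ⟨K, hK, hL⟩ := hf.exists_lipschitz
  have he : ∀ t, HasDerivAt (fun t => a * Real.exp (k * t)) (a * (Real.exp (k * t) * k)) t :=
    fun t => by
      have : HasDerivAt (fun t => k * t) k t := by simpa using (hasDerivAt_id' t).const_mul k
      exact this.exp.const_mul a
  refine ⟨fun T => ?_, fun x hx t => ?_, fun t => ?_, fun t x hx => ?_, fun t x hx => ?_⟩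
  · have hE : ∀ t, |t| ≤ T → |a * Real.exp (k * t)| ≤ |a| * Real.exp (|k| * T) := fun t ht => by
      rw [abs_mul, abs_of_pos (Real.exp_pos _)]
      refine mul_le_mul_of_nonneg_left (Real.exp_le_exp.2 ?_) (abs_nonneg a)
      calc k * t ≤ |k * t| := le_abs_self _
        _ = |k| * |t| := abs_mul _ _
        _ ≤ |k| * T := by gcongr
    refine ⟨|a| * Real.exp (|k| * T) * (1 + K + |k|), fun t ht x hx => ?_⟩
    have hr := hu.range01 t x (subset_closure hx)
    have hu1 : |u t x| ≤ 1 := abs_le.2 ⟨by linarith [hr.1], hr.2⟩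
    have hf1 : |f (u t x)| ≤ K := by
      have := hL (u t x) 0
      rw [hf.f0, sub_zero, sub_zero] at this
      nlinarith
    have hk : |k * u t x| ≤ |k| := by
      rw [abs_mul]; nlinarith [abs_nonneg k]
    constructor
    · rw [abs_mul]
      refine mul_le_mul (hE t ht) ?_ (abs_nonneg _) (by positivity)
      linarith [abs_nonneg k]
    · refine (le_abs_self _).trans ?_
      rw [abs_mul]
      refine mul_le_mul (hE t ht) ?_ (abs_nonneg _) (by positivity)
      linarith [abs_add_le (f (u t x)) (k * u t x)]
  · exact (he t).differentiableAt.mul (hu.time_diff x (subset_closure hx) t)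
  · exact contDiffOn_const.mul (hu.space_reg t)
  · have hx' := subset_closure hx
    rw [((he t).fun_mul (hu.time_diff x hx' t).hasDerivAt).deriv,
      lapW_const_mul hU (hu.space_reg t) _ hx', hu.pde t x hx']
    ring
  · rw [H.normalDeriv_const_mul (hu.space_reg t) _ (H.mem_frontier.1 hx).1]
    have h1 := hu.neumann t x hx
    rw [H.neumannLHS_eq _ hx] at h1
    have h2 : 0 < (Real.sqrt (1 + deriv h (x 0) ^ 2))⁻¹ * (h (x 0))⁻¹ :=
      mul_pos (by positivity) (inv_pos.2 (H.pos _))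
    rw [(mul_eq_zero.1 h1).resolve_left h2.ne', mul_zero]

section

variable {d : ℕ} {h f φ : ℝ → ℝ} {θ c : ℝ} {u : ℝ → Euc d → ℝ} {ρ : Euc d → ℝ}

/-- The moving perturbed front with a coercive correction is a barrier. -/
lemma IsEntireSolution.le_perturbed_add (hf : Bistable f θ) (hφ : PlanarFront f θ c φ)
    (H : Profile h) (X : Exhaustion h ρ) (hρ0 : ∀ x, 0 ≤ ρ x) {C : ℝ} (hC0 : 0 ≤ C)
    (hC : ∀ x ∈ funnel d h, lapW (closure (funnel d h)) ρ x ≤ C)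
    (hu : IsEntireSolution d h f c φ u) {K : ℝ} (hK : 0 < K)
    (hL : ∀ s t : ℝ, |f s - f t| ≤ K * |s - t|) {ε μ ω T : ℝ} (hε : 0 < ε) (hμ : 0 < μ)
    (hω : 0 < ω)
    (hp : ∀ z q : ℝ, 0 ≤ q → q ≤ ε →
      f (φ z + q) - f (φ z) ≤ -(ω * q * deriv φ z) - μ * q)
    (hT : ∀ x ∈ funnel d h, u T x ≤ φ (x 0 - c * T) + ε) {η : ℝ} (hη : 0 < η) {t : ℝ}
    (ht : T < t) {x : Euc d} (hx : x ∈ funnel d h) :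
    1 * Real.exp (-K * t) * u t x ≤
      1 * Real.exp (-K * t) * (φ (x 0 - c * t - ω * ε / μ) + ε) + η * (ρ x + C * (t - T)) := by
  have hU := H.uniqueDiffOn (d := d)
  have hCT : ∀ τ ∈ Ioo T (t + 1), 0 ≤ C * (τ - T) := fun τ hτ =>
    mul_nonneg hC0 (by linarith [hτ.1])
  obtain ⟨q, hq⟩ : ∃ q : ℝ → ℝ, q = fun t => ε * Real.exp (-μ * (t - T)) := ⟨_, rfl⟩
  obtain ⟨p, hpd⟩ : ∃ p : ℝ → ℝ, p = fun t => c * t + ω / μ * (ε - q t) := ⟨_, rfl⟩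
  obtain ⟨E, hE⟩ : ∃ E : ℝ → ℝ, E = fun t => 1 * Real.exp (-K * t) := ⟨_, rfl⟩
  have dq : ∀ t, HasDerivAt q (-μ * q t) t := fun t => by
    have : HasDerivAt (fun t => -μ * (t - T)) (-μ) t := by
      simpa using ((hasDerivAt_id' t).sub_const T).const_mul (-μ)
    rw [hq]
    exact (this.exp.const_mul ε).congr_deriv (by ring)
  have dp : ∀ t, HasDerivAt p (c + ω * q t) t := fun t => by
    have h1 : HasDerivAt (fun t => c * t) c t := by simpa using (hasDerivAt_id' t).const_mul c
    rw [hpd]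
    refine (h1.add (((dq t).const_sub ε).const_mul (ω / μ))).congr_deriv ?_
    field_simp
  have dE : ∀ t, HasDerivAt E (-K * E t) t := fun t => by
    have : HasDerivAt (fun t => -K * t) (-K) t := by
      simpa using (hasDerivAt_id' t).const_mul (-K)
    rw [hE]
    exact (this.exp.const_mul 1).congr_deriv (by ring)
  have q0 : ∀ t, 0 < q t := fun t => by rw [hq]; positivity
  have qε : ∀ t, T ≤ t → q t ≤ ε := fun t ht => by
    rw [hq]
    have : Real.exp (-μ * (t - T)) ≤ 1 := Real.exp_le_one_iff.2 (by nlinarith)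
    simp only
    nlinarith
  have E0 : ∀ t, 0 < E t := fun t => by rw [hE]; positivity
  have ET : ∀ t, T ≤ t → E t ≤ E T := fun t ht => by
    rw [hE]
    simp only [one_mul]
    exact Real.exp_le_exp.2 (by nlinarith)
  have V := hu.evolution hf H 1 (-K)
  obtain ⟨z, hz⟩ : ∃ z : ℝ → Euc d → ℝ, z = fun t x =>
      E t * (φ (x 0 - p t) + q t) + η * (ρ x + C * (t - T)) := ⟨_, rfl⟩
  have dz : ∀ t x, HasDerivAt (fun s => z s x) (-K * E t * (φ (x 0 - p t) + q t)
      + E t * (deriv φ (x 0 - p t) * (-(c + ω * q t)) + -μ * q t) + η * C) t := fun t x => by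
    have h1 : HasDerivAt (fun s => φ (x 0 - p s)) (deriv φ (x 0 - p t) * (-(c + ω * q t))) t :=
      (hφ.differentiable _).hasDerivAt.comp t ((dp t).const_sub (x 0))
    have h2 : HasDerivAt (fun s => η * (ρ x + C * (s - T))) (η * C) t := by
      simpa using ((((hasDerivAt_id' t).sub_const T).const_mul C).const_add (ρ x)).const_mul η
    rw [hz]
    exact ((dE t).mul (h1.add (dq t))).add h2
  have cF : ∀ t, ContDiff ℝ 2 fun s => E t * (φ (s - p t) + q t) := fun t =>
    contDiff_const.mul ((hφ.smooth.comp (contDiff_id.sub contDiff_const)).add contDiff_const)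
  have cFx : ∀ t, ContDiff ℝ 2 fun x : Euc d => E t * (φ (x 0 - p t) + q t) := fun t =>
    (cF t).comp (contDiff_coord 0)
  have dF : ∀ t, deriv (fun s => E t * (φ (s - p t) + q t)) =
      fun s => E t * deriv φ (s - p t) := fun t => by
    ext s
    have h1 : HasDerivAt (fun s => φ (s - p t)) (deriv φ (s - p t)) s :=
      (hφ.differentiable _).hasDerivAt.comp_sub_const s (p t)
    exact ((h1.add_const (q t)).const_mul (E t)).deriv
  have ddF : ∀ t s, deriv (deriv fun s => E t * (φ (s - p t) + q t)) s =
      E t * deriv (deriv φ) (s - p t) := fun t s => by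
    rw [dF]
    have h1 : HasDerivAt (fun s => deriv φ (s - p t)) (deriv (deriv φ) (s - p t)) s :=
      ((hφ.contDiff_deriv.differentiable (by norm_num)) _).hasDerivAt.comp_sub_const s (p t)
    exact (h1.const_mul (E t)).deriv
  have cρ : ∀ t, ContDiff ℝ 2 fun x : Euc d => η * (ρ x + C * (t - T)) := fun t =>
    contDiff_const.mul (X.smooth.add contDiff_const)
  have Z : Barrier h ρ (fun t x => 1 * Real.exp (-K * t) * u t x)
      (fun t x => 1 * Real.exp (-K * t) * (f (u t x) + -K * u t x)) z T (t + 1)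
      (E T / η) := by
    refine ⟨fun τ hτ => ?_, fun τ hτ x hx => (dz τ x).differentiableAt, ?_, fun τ hτ x hx => ?_,
      fun τ hτ x hx hr => ?_, fun τ hτ x hx hlt => ?_⟩
    · rw [hz]
      exact ((cFx τ).add (cρ τ)).contDiffOn
    · refine ⟨K * E T * (1 + ε) + E T * (μ * ε), fun τ hτ x hx => ?_⟩
      have a1 := E0 τ
      have a2 := ET τ hτ.1.le
      have a3 := q0 τ
      have a4 := qε τ hτ.1.le
      have a5 := hφ.mem (x 0 - p τ)
      have a6 := hφ.deriv_nonpos (x 0 - p τ)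
      have a9 := mul_nonneg hη.le (hCT τ hτ)
      have a10 : 0 ≤ E τ * (φ (x 0 - p τ) + q τ) := mul_nonneg a1.le (by linarith [a5.1])
      have a11 : E τ * (φ (x 0 - p τ) + q τ) ≤ E T * (1 + ε) :=
        mul_le_mul a2 (by linarith [a5.2]) (by linarith [a5.1]) (E0 T).le
      have a12 : E τ * (μ * q τ) ≤ E T * (μ * ε) :=
        mul_le_mul a2 (by gcongr) (by positivity) (E0 T).le
      have a13 : 0 ≤ E τ * (deriv φ (x 0 - p τ) * (-(c + ω * q τ))) := by
        have : 0 < c + ω * q τ := by have := hφ.cpos; positivity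
        exact mul_nonneg a1.le (by nlinarith)
      have a14 : 0 ≤ η * C := by positivity
      have a15 : 0 ≤ K * E T * (1 + ε) := by have := E0 T; positivity
      have a16 : 0 ≤ E T * (μ * ε) := by have := E0 T; positivity
      have a18 := mul_nonneg hη.le (hρ0 x)
      constructor
      · rw [hz]; simp only; linarith
      · rw [(dz τ x).deriv]
        have := mul_le_mul_of_nonneg_left a11 hK.le
        linarith
    · have hx' := (H.mem_frontier.1 hx).1
      rw [hz, H.normalDeriv_add (cFx τ).contDiffOn (cρ τ).contDiffOn hx',
        H.normalDeriv_eq_fderiv (cFx τ) hx', fderiv_coord_comp (cF τ), dF,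
        H.normalDeriv_const_mul (X.smooth.add contDiff_const).contDiffOn _ hx',
        H.normalDeriv_add X.smooth.contDiffOn contDiffOn_const hx', normalDeriv_const, add_zero]
      have h1 : outNormal h x 0 = -(h (x 0) * deriv h (x 0)) := rfl
      rw [h1]
      have h2 := mul_nonneg hη.le (X.neu x hx)
      have h3 := mul_nonneg (H.pos (x 0)).le (H.mono.deriv_nonneg (x := x 0))
      have h4 := mul_nonneg (E0 τ).le (neg_nonneg.2 (hφ.deriv_nonpos (x 0 - p τ)))
      have h5 := mul_nonneg h4 h3
      simp only
      linarith
    · have a1 := E0 τ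
      have a2 := ET τ hτ.1.le
      have a3 := q0 τ
      have a5 := hφ.mem (x 0 - p τ)
      have a6 := hu.range01 τ x (subset_closure hx)
      have a10 : 0 ≤ E τ * (φ (x 0 - p τ) + q τ) := mul_nonneg a1.le (by linarith [a5.1])
      have h1 : E T ≤ η * (ρ x + C * (τ - T)) := by
        rw [← div_le_iff₀' hη]; linarith [hCT τ hτ]
      have h2 : 1 * Real.exp (-K * τ) * u τ x ≤ E T := by
        have : E τ = 1 * Real.exp (-K * τ) := by rw [hE]
        rw [← this]
        nlinarith [a6.1, a6.2]
      rw [hz]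
      simp only
      linarith
    · have hx' := subset_closure hx
      have hEτ : 1 * Real.exp (-K * τ) = E τ := by rw [hE]
      rw [(dz τ x).deriv]
      simp only [hEτ] at hlt ⊢
      have hlap : lapW (closure (funnel d h)) (z τ) x
          = E τ * deriv (deriv φ) (x 0 - p τ) + η * lapW (closure (funnel d h)) ρ x := by
        rw [hz, lapW_add hU (cFx τ).contDiffOn (cρ τ).contDiffOn hx',
          lapW_coord_comp (F := fun s => E τ * (φ (s - p τ) + q τ)) hU (cF τ) hx', ddF,
          lapW_const_mul hU (X.smooth.add contDiff_const).contDiffOn _ hx',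
          lapW_add hU X.smooth.contDiffOn contDiffOn_const hx', lapW_const, add_zero]
      rw [hlap]
      have a1 := E0 τ
      have b1 : φ (x 0 - p τ) + q τ < u τ x := by
        have : E τ * (φ (x 0 - p τ) + q τ) < E τ * u τ x := by
          rw [hz] at hlt
          have := mul_nonneg hη.le (add_nonneg (hρ0 x) (hCT τ hτ))
          simp only at hlt
          linarith
        exact lt_of_mul_lt_mul_left this a1.le
      have b2 := le_of_abs_le (hL (u τ x) (φ (x 0 - p τ) + q τ))
      rw [abs_of_pos (sub_pos.2 b1)] at b2
      have b3 := hp (x 0 - p τ) (q τ) (q0 τ).le (qε τ hτ.1.le)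
      have b4 := hφ.ode (x 0 - p τ)
      have b5 := mul_le_mul_of_nonneg_left (hC x hx) hη.le
      have b6 : deriv (deriv φ) (x 0 - p τ) + (f (u τ x) + -K * u τ x) ≤
          -K * (φ (x 0 - p τ) + q τ)
            + (deriv φ (x 0 - p τ) * (-(c + ω * q τ)) + -μ * q τ) := by linarith
      have b7 := mul_le_mul_of_nonneg_left b6 a1.le
      linarith
  have main := Z.le H X V (fun x hx => (dz T x).continuousAt.tendsto.mono_left nhdsWithin_le_nhds)
    (fun x hx => ?_) t ⟨ht, by linarith⟩ x hx
  · have hEt : 1 * Real.exp (-K * t) = E t := by rw [hE]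
    rw [hEt] at main ⊢
    refine main.trans ?_
    rw [hz]
    simp only
    have h1 : p t ≤ c * t + ω * ε / μ := by
      rw [hpd]
      have : 0 ≤ ω / μ * q t := by have := q0 t; positivity
      have h2 : ω / μ * ε = ω * ε / μ := by ring
      simp only
      linarith
    have h2 := hφ.anti.antitone (show x 0 - c * t - ω * ε / μ ≤ x 0 - p t by linarith)
    have h3 := qε t ht.le
    have := mul_le_mul_of_nonneg_left (add_le_add h2 h3) (E0 t).le
    linarith
  · have hET : 1 * Real.exp (-K * T) = E T := by rw [hE]
    have hqT : q T = ε := by rw [hq]; simp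
    have hpT : p T = c * T := by rw [hpd]; simp [hqT]
    rw [hET, hz]
    simp only
    rw [hqT, hpT, sub_self, mul_zero, add_zero]
    have := mul_le_mul_of_nonneg_left (hT x hx) (E0 T).le
    have := mul_nonneg hη.le (hρ0 x)
    linarith

/-- The solution never goes ahead of the planar front. -/
lemma IsEntireSolution.le_front (hf : Bistable f θ) (hφ : PlanarFront f θ c φ)
    (H : Profile h) (X : Exhaustion h ρ) (hρ0 : ∀ x, 0 ≤ ρ x) {C : ℝ} (hC0 : 0 ≤ C)
    (hC : ∀ x ∈ funnel d h, lapW (closure (funnel d h)) ρ x ≤ C)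
    (hu : IsEntireSolution d h f c φ u) (t : ℝ) {x : Euc d} (hx : x ∈ closure (funnel d h)) :
    u t x ≤ φ (x 0 - c * t) := by
  have key : ∀ x ∈ funnel d h, u t x ≤ φ (x 0 - c * t) := by
    intro x hx
    obtain ⟨K, hK, hL⟩ := hf.exists_lipschitz
    obtain ⟨δ, hδ, μ, hμ, ω, hω, hp⟩ := hφ.exists_perturbation hf
    have step : ∀ ε, 0 < ε → ε < δ → u t x ≤ φ (x 0 - c * t - ω * ε / μ) + ε := by
      intro ε hε hεδ
      obtain ⟨T₀, hT₀⟩ := hu.past ε hε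
      set T := min T₀ (t - 1)
      have hTt : T < t := (min_le_right _ _).trans_lt (by linarith)
      have hT : ∀ x ∈ funnel d h, u T x ≤ φ (x 0 - c * T) + ε := fun x hx => by
        linarith [le_of_abs_le (hT₀ T (min_le_left _ _) x (subset_closure hx))]
      have h1 : ∀ η > 0, 1 * Real.exp (-K * t) * u t x ≤
          1 * Real.exp (-K * t) * (φ (x 0 - c * t - ω * ε / μ) + ε)
            + η * (ρ x + C * (t - T)) := fun η hη =>
        hu.le_perturbed_add hf hφ H X hρ0 hC0 hC hK hL hε hμ hω
          (fun z q h0 h1 => hp z q h0 (h1.trans hεδ.le)) hT hη hTt hx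
      have h2 : Tendsto (fun η : ℝ => 1 * Real.exp (-K * t) * (φ (x 0 - c * t - ω * ε / μ) + ε)
            + η * (ρ x + C * (t - T))) (𝓝[>] 0)
          (𝓝 (1 * Real.exp (-K * t) * (φ (x 0 - c * t - ω * ε / μ) + ε)
            + 0 * (ρ x + C * (t - T)))) :=
        (Continuous.tendsto (by fun_prop) 0).mono_left nhdsWithin_le_nhds
      have h3 := ge_of_tendsto h2 (eventually_mem_nhdsWithin.mono h1)
      rw [zero_mul, add_zero] at h3
      exact le_of_mul_le_mul_left h3 (by positivity)
    have h2 : Tendsto (fun ε : ℝ => φ (x 0 - c * t - ω * ε / μ) + ε) (𝓝[>] 0)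
        (𝓝 (φ (x 0 - c * t - ω * 0 / μ) + 0)) := by
      have := hφ.smooth.continuous
      exact (Continuous.tendsto (by fun_prop) 0).mono_left nhdsWithin_le_nhds
    have h3 := ge_of_tendsto h2 ((Ioo_mem_nhdsGT hδ : Ioo 0 δ ∈ 𝓝[>] (0 : ℝ)) |>
      fun hm => Filter.mem_of_superset hm fun ε hε => step ε hε.1 hε.2)
    simpa using h3
  refine le_on_closure key (hu.space_reg t).continuousOn ?_ hx
  have h1 := hφ.smooth.continuous
  have h2 : Continuous fun x : Euc d => x 0 := (contDiff_coord (n := 0) 0).continuous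
  exact (h1.comp (h2.sub continuous_const)).continuousOn

end

lemma hasDerivAt_max_const_sub_cube (m s : ℝ) :
    HasDerivAt (fun s : ℝ => max (m - s) 0 ^ 3) (-(3 * max (m - s) 0 ^ 2)) s := by
  have h1 := (hasDerivAt_max_zero_pow 1 (m - s)).comp_const_sub m s
  refine h1.congr_deriv ?_
  norm_num

lemma hasDerivAt_max_const_sub_sq (m s : ℝ) :
    HasDerivAt (fun s : ℝ => max (m - s) 0 ^ 2) (-(2 * max (m - s) 0)) s := by
  have h1 := (hasDerivAt_max_zero_pow 0 (m - s)).comp_const_sub m s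
  refine h1.congr_deriv ?_
  norm_num

lemma deriv_mul_max_const_sub_cube (a m : ℝ) :
    deriv (fun s : ℝ => a * max (m - s) 0 ^ 3) = fun s => -(3 * a) * max (m - s) 0 ^ 2 := by
  ext s
  rw [((hasDerivAt_max_const_sub_cube m s).const_mul a).deriv]
  ring

lemma deriv_deriv_mul_max_const_sub_cube (a m s : ℝ) :
    deriv (deriv fun s : ℝ => a * max (m - s) 0 ^ 3) s = 6 * a * max (m - s) 0 := by
  rw [deriv_mul_max_const_sub_cube, ((hasDerivAt_max_const_sub_sq m s).const_mul _).deriv]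
  ring

lemma contDiff_mul_max_const_sub_cube (a m : ℝ) :
    ContDiff ℝ 2 fun s : ℝ => a * max (m - s) 0 ^ 3 :=
  contDiff_const.mul (contDiff_max_zero_cube.comp (contDiff_const.sub contDiff_id))

section

variable {d : ℕ} {h f φ : ℝ → ℝ} {θ c : ℝ} {u : ℝ → Euc d → ℝ} {ρ : Euc d → ℝ}

/-- Positivity spreads from a sublevel set of the exhaustion function to the whole domain. -/
lemma IsEntireSolution.pos_of_initial (hf : Bistable f θ)
    (H : Profile h) (X : Exhaustion h ρ) (hρ0 : ∀ x, 0 ≤ ρ x) {C : ℝ} (hC0 : 0 ≤ C)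
    (hC : ∀ x ∈ funnel d h, lapW (closure (funnel d h)) ρ x ≤ C)
    (hu : IsEntireSolution d h f c φ u) {r₀ κ T t₁ : ℝ} (hr₀ : 0 < r₀) (hκ0 : 0 < κ)
    (hκ : ∀ x ∈ closure (funnel d h), r₀ / 2 ≤ ρ x → κ ≤
      ∑ i, fderivWithin ℝ ρ (closure (funnel d h)) x (EuclideanSpace.single i 1) ^ 2)
    (hT : ∀ x ∈ funnel d h, ρ x < r₀ → 1 / 2 ≤ u T x) (ht : T < t₁) {x₁ : Euc d}
    (hx₁ : x₁ ∈ closure (funnel d h)) : 0 < u t₁ x₁ := by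
  have hU := H.uniqueDiffOn (d := d)
  obtain ⟨K, hK, hL⟩ := hf.exists_lipschitz
  obtain ⟨k, hk⟩ : ∃ k, k = (ρ x₁ + 1) / (t₁ - T) := ⟨_, rfl⟩
  have htT : 0 < t₁ - T := sub_pos.2 ht
  have hk0 : 0 < k := by rw [hk]; have := hρ0 x₁; positivity
  obtain ⟨N, hN⟩ : ∃ N, N = k + C := ⟨_, rfl⟩
  have hN0 : 0 < N := by rw [hN]; positivity
  obtain ⟨Λ, hΛ⟩ : ∃ Λ, Λ = N ^ 2 / κ + 6 * N / r₀ := ⟨_, rfl⟩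
  have hΛ0 : 0 < Λ := by rw [hΛ]; positivity
  obtain ⟨η, hη⟩ : ∃ η, η = Real.exp (K * T) / 2 / r₀ ^ 3 := ⟨_, rfl⟩
  have hη0 : 0 < η := by rw [hη]; positivity
  obtain ⟨a, ha⟩ : ∃ a : ℝ → ℝ, a = fun t => η * Real.exp (-Λ * (t - T)) := ⟨_, rfl⟩
  obtain ⟨m, hm⟩ : ∃ m : ℝ → ℝ, m = fun t => r₀ + k * (t - T) := ⟨_, rfl⟩
  have da : ∀ t, HasDerivAt a (-Λ * a t) t := fun t => by
    have : HasDerivAt (fun t => -Λ * (t - T)) (-Λ) t := by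
      simpa using ((hasDerivAt_id' t).sub_const T).const_mul (-Λ)
    rw [ha]
    exact (this.exp.const_mul η).congr_deriv (by ring)
  have dm : ∀ t, HasDerivAt m k t := fun t => by
    rw [hm]
    simpa using (((hasDerivAt_id' t).sub_const T).const_mul k).const_add r₀
  have a0 : ∀ t, 0 < a t := fun t => by rw [ha]; positivity
  have aη : ∀ t, T ≤ t → a t ≤ η := fun t ht => by
    rw [ha]
    have : Real.exp (-Λ * (t - T)) ≤ 1 := Real.exp_le_one_iff.2 (by nlinarith)
    simp only
    nlinarith
  have mr : ∀ t, T ≤ t → r₀ ≤ m t := fun t ht => by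
    rw [hm]; have := mul_nonneg hk0.le (sub_nonneg.2 ht); simp only; linarith
  obtain ⟨r, hr⟩ : ∃ r, r = m (t₁ + 1) := ⟨_, rfl⟩
  have hr0 : 0 < r := by rw [hr]; linarith [mr (t₁ + 1) (by linarith)]
  have mle : ∀ t, t ≤ t₁ + 1 → m t ≤ r := fun t ht => by
    rw [hr, hm]
    have := mul_le_mul_of_nonneg_left (sub_le_sub_right ht T) hk0.le
    simp only
    linarith
  obtain ⟨z, hz⟩ : ∃ z : ℝ → Euc d → ℝ, z = fun t x => -a t * max (m t - ρ x) 0 ^ 3 :=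
    ⟨_, rfl⟩
  have dz : ∀ t x, HasDerivAt (fun s => z s x) (Λ * a t * max (m t - ρ x) 0 ^ 3
      - 3 * a t * k * max (m t - ρ x) 0 ^ 2) t := fun t x => by
    have h1 := HasDerivAt.comp (h := fun s => m s - ρ x) t
      (hasDerivAt_max_zero_pow 1 (m t - ρ x)) ((dm t).sub_const (ρ x))
    rw [hz]
    refine ((da t).fun_neg.mul h1).congr_deriv ?_
    norm_num
    ring
  have cz : ∀ t, ContDiff ℝ 2 (z t) := fun t => by
    rw [hz]
    exact (contDiff_mul_max_const_sub_cube (-a t) (m t)).comp X.smooth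
  have Z : Barrier h ρ (fun t x => -1 * Real.exp (K * t) * u t x)
      (fun t x => -1 * Real.exp (K * t) * (f (u t x) + K * u t x)) z T (t₁ + 1) r := by
    refine ⟨fun τ hτ => (cz τ).contDiffOn, fun τ hτ x hx => (dz τ x).differentiableAt, ?_,
      fun τ hτ x hx => ?_, fun τ hτ x hx hrx => ?_, fun τ hτ x hx _ => ?_⟩
    · refine ⟨η * r ^ 3 + 3 * η * k * r ^ 2, fun τ hτ x hx => ?_⟩
      have b1 := a0 τ
      have b2 := aη τ hτ.1.le
      have b3 : 0 ≤ max (m τ - ρ x) 0 := le_max_right _ _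
      have b4 : max (m τ - ρ x) 0 ≤ r :=
        max_le (by linarith [mle τ hτ.2.le, hρ0 x]) hr0.le
      have b5 : a τ * max (m τ - ρ x) 0 ^ 3 ≤ η * r ^ 3 := by gcongr
      have b6 : 3 * a τ * k * max (m τ - ρ x) 0 ^ 2 ≤ 3 * η * k * r ^ 2 := by gcongr
      have b7 : 0 ≤ η * r ^ 3 := by positivity
      have b8 : 0 ≤ 3 * η * k * r ^ 2 := by positivity
      have b9 : 0 ≤ Λ * a τ * max (m τ - ρ x) 0 ^ 3 := by positivity
      constructor
      · rw [hz]; simp only; linarith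
      · rw [(dz τ x).deriv]; linarith
    · have hx' := (H.mem_frontier.1 hx).1
      have h1 := H.normalDeriv_comp X.smooth.contDiffOn
        (contDiff_mul_max_const_sub_cube (-a τ) (m τ)) hx'
      rw [hz]
      simp only
      rw [h1, deriv_mul_max_const_sub_cube]
      have := a0 τ
      refine mul_nonneg ?_ (X.neu x hx)
      simp only [mul_neg, neg_neg]
      positivity
    · have h1 : max (m τ - ρ x) 0 = 0 := max_eq_right (by linarith [mle τ hτ.2.le])
      rw [hz]
      simp only [h1]
      have := mul_nonneg (Real.exp_pos (K * τ)).le (hu.range01 τ x (subset_closure hx)).1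
      linarith
    · have hx' := subset_closure hx
      have hlap := lapW_comp hU X.smooth.contDiffOn
        (contDiff_mul_max_const_sub_cube (-a τ) (m τ)) hx'
      rw [deriv_deriv_mul_max_const_sub_cube, deriv_mul_max_const_sub_cube] at hlap
      simp only at hlap
      have hg : -1 * Real.exp (K * τ) * (f (u τ x) + K * u τ x) ≤ 0 := by
        have h1 := neg_le_of_abs_le (hL (u τ x) 0)
        have h2 := (hu.range01 τ x hx').1
        rw [hf.f0, sub_zero, sub_zero, abs_of_nonneg h2] at h1
        have := mul_nonneg (Real.exp_pos (K * τ)).le (show 0 ≤ f (u τ x) + K * u τ x by linarith)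
        linarith
      have hzl : lapW (closure (funnel d h)) (z τ) x = lapW (closure (funnel d h))
        (fun y => -a τ * max (m τ - ρ y) 0 ^ 3) x := by rw [hz]
      rw [hzl, hlap, (dz τ x).deriv]
      have b1 := a0 τ
      have b2 := hC x hx
      have b3 : 0 ≤ max (m τ - ρ x) 0 := le_max_right _ _
      have b4 : m τ - ρ x ≤ max (m τ - ρ x) 0 := le_max_left _ _
      have b5 : 0 ≤ ∑ i, fderivWithin ℝ ρ (closure (funnel d h)) x
        (EuclideanSpace.single i 1) ^ 2 := Finset.sum_nonneg fun _ _ => sq_nonneg _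
      have b6 := hκ x hx'
      have b7 := mr τ hτ.1.le
      generalize ∑ i, fderivWithin ℝ ρ (closure (funnel d h)) x
        (EuclideanSpace.single i 1) ^ 2 = S at *
      generalize lapW (closure (funnel d h)) ρ x = Δ at *
      generalize max (m τ - ρ x) 0 = Y at *
      have key : 3 * N * Y ≤ 6 * S + Λ * Y ^ 2 := by
        rcases le_or_gt (r₀ / 2) (ρ x) with hc | hc
        · have c1 := b6 hc
          have c2 : N ^ 2 / κ * Y ^ 2 ≤ Λ * Y ^ 2 := by
            rw [hΛ]
            have : 0 ≤ 6 * N / r₀ := by positivity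
            nlinarith [sq_nonneg Y]
          have c3 : 3 * N * Y ≤ 6 * κ + N ^ 2 / κ * Y ^ 2 := by
            have : 6 * κ + N ^ 2 / κ * Y ^ 2 - 3 * N * Y
                = (6 * κ ^ 2 + (N * Y) ^ 2 - 3 * κ * (N * Y)) / κ := by field_simp
            rw [← sub_nonneg, this]
            refine div_nonneg ?_ hκ0.le
            nlinarith [sq_nonneg (N * Y - 3 / 2 * κ), sq_nonneg κ]
          linarith
        · have c1 : r₀ / 2 ≤ Y := by linarith
          have c2 : 6 * N / r₀ ≤ Λ := by
            rw [hΛ]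
            have : 0 ≤ N ^ 2 / κ := by positivity
            linarith
          have c3 : 3 * N ≤ Λ * Y := by
            have : 3 * N = 6 * N / r₀ * (r₀ / 2) := by field_simp; norm_num
            rw [this]
            exact mul_le_mul c2 c1 (by positivity) hΛ0.le
          have := mul_le_mul_of_nonneg_right c3 b3
          nlinarith
      have k2 : 3 * (k + Δ) * Y ≤ 6 * S + Λ * Y ^ 2 := by
        refine le_trans ?_ key
        rw [hN]
        gcongr
      have k3 := mul_le_mul_of_nonneg_left k2 (mul_nonneg b1.le b3)
      linarith
  have hmt : m t₁ = r₀ + (ρ x₁ + 1) := by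
    rw [hm, hk]; simp only; rw [div_mul_cancel₀ _ htT.ne']
  have V := hu.evolution hf H (-1) K
  have main := Z.le H X V (fun x hx => (dz T x).continuousAt.tendsto.mono_left nhdsWithin_le_nhds)
    (fun x hx => ?_) t₁ ⟨ht, by linarith⟩
  · have h1 := le_on_closure main (contDiffOn_const.mul (hu.space_reg t₁)).continuousOn
      (cz t₁).continuous.continuousOn hx₁
    rw [hz] at h1
    simp only at h1
    have h2 : 0 < max (m t₁ - ρ x₁) 0 := lt_max_of_lt_left (by rw [hmt]; linarith)
    have h3 : 0 < a t₁ * max (m t₁ - ρ x₁) 0 ^ 3 := mul_pos (a0 t₁) (by positivity)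
    have h4 : 0 < Real.exp (K * t₁) * u t₁ x₁ := by linarith
    exact pos_of_mul_pos_right h4 (Real.exp_pos _).le
  · have haT : a T = η := by rw [ha]; simp
    have hmT : m T = r₀ := by rw [hm]; simp
    rw [hz]
    simp only [haT, hmT]
    rcases lt_or_ge (ρ x) r₀ with hc | hc
    · have h1 : max (r₀ - ρ x) 0 ^ 3 ≤ r₀ ^ 3 := by
        have : max (r₀ - ρ x) 0 ≤ r₀ := max_le (by linarith [hρ0 x]) hr₀.le
        gcongr
      have h2 : η * r₀ ^ 3 = Real.exp (K * T) / 2 := by rw [hη]; field_simp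
      have h3 := mul_le_mul_of_nonneg_left h1 hη0.le
      have h4 := mul_le_mul_of_nonneg_left (hT x hx hc) (Real.exp_pos (K * T)).le
      linarith
    · rw [max_eq_right (by linarith : r₀ - ρ x ≤ 0)]
      have := mul_nonneg (Real.exp_pos (K * T)).le (hu.range01 T x (subset_closure hx)).1
      linarith

end

/-- Solutions emanating from the planar front are positive. -/
lemma IsEntireSolution.pos {d : ℕ} {h f φ : ℝ → ℝ} {θ c : ℝ} {u : ℝ → Euc d → ℝ}
    (hf : Bistable f θ) (hφ : PlanarFront f θ c φ) (H : Profile h) {B : ℝ} (hB : 0 < B)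
    (X : ∀ y, Exhaustion h (heightFun (d := d) B y)) (hu : IsEntireSolution d h f c φ u) (t : ℝ)
    {x : Euc d} (hx : x ∈ closure (funnel d h)) : 0 < u t x := by
  have hU := H.uniqueDiffOn (d := d)
  obtain ⟨T₀, hT₀⟩ := hu.past (1 / 4) (by norm_num)
  set T := min T₀ (t - 1)
  have hTt : T < t := (min_le_right _ _).trans_lt (by linarith)
  obtain ⟨a, ha⟩ := eventually_atBot.1 (hφ.lim_bot.eventually (eventually_gt_nhds
    (show (3 / 4 : ℝ) < 1 by norm_num)))
  set y := a + c * T - 1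
  obtain ⟨κ, hκ0, hκ⟩ := exists_le_sum_sq_fderivWithin_heightFun hU hB y
    (show 0 < B / 4 / 2 by positivity)
  refine hu.pos_of_initial (r₀ := B / 4) (κ := κ) (T := T) (C := 2 * d + B) hf H (X y)
    (fun x => heightFun_nonneg hB.le y x) (by positivity)
    (fun x hx => lapW_heightFun_le hU hB.le y (subset_closure hx)) (by positivity) hκ0 hκ
    (fun x hx hr => ?_) hTt hx
  have h1 : x 0 - y < 1 := by
    refine lt_one_of_spread_lt ?_
    have := sqPrime_nonneg x
    rw [heightFun] at hr
    have h2 : B * spread (x 0 - y) < B * (1 / 4) := by linarith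
    exact lt_of_mul_lt_mul_left h2 hB.le
  have h2 := ha (x 0 - c * T) (by simp only [y] at h1; linarith)
  have h3 := neg_le_of_abs_le (hT₀ T (min_le_left _ _) x (subset_closure hx))
  linarith

/-- inequality (2.5): the entire solution emanating from the planar front
satisfies `0 < u(t,x) ≤ φ(x₁ - ct)`, i.e. it never goes ahead of the planar front. -/
theorem statement19 (d : ℕ) (f φ h : ℝ → ℝ) (θ c R α L : ℝ)
    (hf : Bistable f θ) (hφ : PlanarFront f θ c φ) (hΩ : IsFunnel d R α L h)
    (u : ℝ → Euc d → ℝ) (hu : IsEntireSolution d h f c φ u) :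
    ∀ t : ℝ, ∀ x ∈ closure (funnel d h), 0 < u t x ∧ u t x ≤ φ (x 0 - c * t) := by
  have H := hΩ.profile
  have hA : 0 ≤ Real.tan α := (hΩ.deriv_nonneg 0).trans (hΩ.deriv_le 0)
  have hB : 0 < R / (1 + Real.tan α) := div_pos hΩ.Rpos (by linarith)
  have X := fun y => H.exhaustion_heightFun (d := d) hΩ.Rpos hA hΩ.le_profile hΩ.deriv_le y
  exact fun t x hx => ⟨hu.pos hf hφ H hB X t hx,
    hu.le_front (C := 2 * d + R / (1 + Real.tan α)) hf hφ H (X 0)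
      (fun x => heightFun_nonneg hB.le 0 x) (by positivity)
      (fun x hx => lapW_heightFun_le H.uniqueDiffOn hB.le 0 (subset_closure hx)) t hx⟩

end
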